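/- arXiv:1902.06402 — 6 statements merged into one kernel-verified Lean document; each statement's English description precedes it below -/
import Mathlib

section
/- Let G be an infinite locally finite connected graph and let F be a faithful spanning subgraph of G with D ≤ F ≤ G, where D, F, G are graphs with D a subgraph of F and F a subgraph of G. Then any two of the following three statements imply the third: (1) D is faithful to F; (2) F is faithful to G; (3) D is faithful to G. -/
namespace IGraph

open SimpleGraph

universe u w

variable {V : Type u} {W : Type w}

/-- `G` is locally finite: every vertex has finite degree. -/
def LocFin (G : SimpleGraph V) : Prop := ∀ v : V, (G.neighborSet v).Finite

/-- A ray of `G`: a one-way infinite path, given by an injective sequence of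
successively adjacent vertices. -/
def IsRay (G : SimpleGraph V) (R : ℕ → V) : Prop :=
  Function.Injective R ∧ ∀ n : ℕ, G.Adj (R n) (R (n + 1))

/-- `G − S`, kept on the same vertex type (removed vertices become isolated). -/
def del (G : SimpleGraph V) (S : Set V) : SimpleGraph V where
  Adj a b := G.Adj a b ∧ a ∉ S ∧ b ∉ S
  symm := ⟨fun a b h => ⟨h.1.symm, h.2.2, h.2.1⟩⟩
  loopless := ⟨fun a h => G.loopless.irrefl a h.1⟩

/-- Two rays are equivalent in `G` if for every finite `S ⊆ V(G)` some component of
`G − S` contains a tail of both. -/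
def RayEquiv (G : SimpleGraph V) (R₁ R₂ : ℕ → V) : Prop :=
  ∀ S : Set V, S.Finite →
    ∃ m n : ℕ, (∀ i, m ≤ i → R₁ i ∉ S) ∧ (∀ j, n ≤ j → R₂ j ∉ S) ∧
      (del G S).Reachable (R₁ m) (R₂ n)

/-- `F` is a faithful subgraph of `G` (both presented on the same vertex type):
(1) every end of `G` contains a ray of `F`, and (2) two rays of `F` are equivalent in `F`
iff they are equivalent in `G`. -/
def Faithful (F G : SimpleGraph V) : Prop :=
  (∀ R : ℕ → V, IsRay G R → ∃ R' : ℕ → V, IsRay F R' ∧ RayEquiv G R R') ∧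
  ∀ R₁ R₂ : ℕ → V, IsRay F R₁ → IsRay F R₂ → (RayEquiv F R₁ R₂ ↔ RayEquiv G R₁ R₂)

/-- `N_G(X)`: vertices outside `X` with a neighbor in `X`. -/
def NSet (G : SimpleGraph V) (X : Set V) : Set V := {y | y ∉ X ∧ ∃ x ∈ X, G.Adj x y}

/-- `Z_G(X)`: vertices of `X` with a neighbor outside `X`. -/
def ZSet (G : SimpleGraph V) (X : Set V) : Set V := {x | x ∈ X ∧ ∃ y, y ∉ X ∧ G.Adj x y}

/-- The vertex set of the component of `G − S` containing `v`. -/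
def compOf (G : SimpleGraph V) (S : Set V) (v : V) : Set V := {x | (del G S).Reachable v x}

/-- The degree of the end of `G` represented by the ray `R`: the supremum of the numbers of
pairwise vertex-disjoint rays equivalent to `R`. -/
noncomputable def endDegree (G : SimpleGraph V) (R : ℕ → V) : ℕ∞ :=
  ⨆ n ∈ {n : ℕ | ∃ f : Fin n → ℕ → V,
      (∀ i, IsRay G (f i) ∧ RayEquiv G (f i) R) ∧
      ∀ i j, i ≠ j → Disjoint (Set.range (f i)) (Set.range (f j))}, (n : ℕ∞)

/-- `H` is `k`-connected: `|V(H)| > k` and removing fewer than `k` vertices leaves a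
connected graph. -/
def IsKConn (k : ℕ) (H : SimpleGraph W) : Prop :=
  (k : Cardinal) < Cardinal.mk W ∧
    ∀ X : Set W, X.Finite → X.ncard < k → (H.induce Xᶜ).Connected

/-- Every vertex has degree at most 3. -/
def Subcubic (G : SimpleGraph V) : Prop :=
  ∀ v : V, (G.neighborSet v).Finite ∧ (G.neighborSet v).ncard ≤ 3

/-- Every vertex has degree exactly 3. -/
def Cubic (G : SimpleGraph V) : Prop := ∀ v : V, (G.neighborSet v).ncard = 3

/-- `S` is 3-connected in `G`: every two vertices of `S` are joined by three pairwise
internally disjoint paths of `G`. -/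
def ThreeConnIn (G : SimpleGraph V) (S : Set V) : Prop :=
  ∀ u v : V, u ∈ S → v ∈ S → u ≠ v →
    ∃ p₁ p₂ p₃ : G.Path u v,
      p₁ ≠ p₂ ∧ p₁ ≠ p₃ ∧ p₂ ≠ p₃ ∧
      (∀ x, x ∈ (p₁ : G.Walk u v).support → x ∈ (p₂ : G.Walk u v).support → x = u ∨ x = v) ∧
      (∀ x, x ∈ (p₁ : G.Walk u v).support → x ∈ (p₃ : G.Walk u v).support → x = u ∨ x = v) ∧
      (∀ x, x ∈ (p₂ : G.Walk u v).support → x ∈ (p₃ : G.Walk u v).support → x = u ∨ x = v)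

/-- A subgraph which is a (finite) cycle: finite, nonempty, connected and 2-regular. -/
def IsCycleSub {G : SimpleGraph W} (C : G.Subgraph) : Prop :=
  C.verts.Finite ∧ C.verts.Nonempty ∧ C.Connected ∧
    ∀ v ∈ C.verts, (C.neighborSet v).ncard = 2

/-- A cactus: a connected subcubic graph whose cycles are pairwise vertex-disjoint and whose
edges decompose into vertex-disjoint cycles and vertex-disjoint paths (equivalently, every
vertex on no cycle has degree at most 2). -/
def IsCactus (H : SimpleGraph W) : Prop :=
  H.Connected ∧ Subcubic H ∧
  (∀ C₁ C₂ : H.Subgraph, IsCycleSub C₁ → IsCycleSub C₂ → C₁ ≠ C₂ →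
    Disjoint C₁.verts C₂.verts) ∧
  ∀ v : W, (∀ C : H.Subgraph, IsCycleSub C → v ∉ C.verts) → (H.neighborSet v).ncard ≤ 2

/-- A semi-cactus: connected, maximum degree at most 4, every block is a cycle or a `K₂`
(equivalently, distinct cycles are edge-disjoint), and every vertex lies in at most two
blocks (cycles through `v` together with bridges at `v` number at most 2). -/
def IsSemiCactus (H : SimpleGraph W) : Prop :=
  H.Connected ∧ (∀ v : W, (H.neighborSet v).Finite ∧ (H.neighborSet v).ncard ≤ 4) ∧
  (∀ C₁ C₂ : H.Subgraph, IsCycleSub C₁ → IsCycleSub C₂ → C₁ ≠ C₂ →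
    Disjoint C₁.edgeSet C₂.edgeSet) ∧
  ∀ v : W,
    {C : H.Subgraph | IsCycleSub C ∧ v ∈ C.verts}.encard +
      {e : Sym2 W | e ∈ H.edgeSet ∧ v ∈ e ∧
        ∀ C : H.Subgraph, IsCycleSub C → e ∉ C.edgeSet}.encard ≤ 2

/-- Every cycle of `H` is even. -/
def EvenCycles (H : SimpleGraph W) : Prop :=
  ∀ C : H.Subgraph, IsCycleSub C → Even C.verts.ncard

/-- `v` is a cut-vertex of `H`: removing `v` separates two vertices. -/
def IsCutVert (H : SimpleGraph W) (v : W) : Prop :=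
  ∃ a b : W, a ≠ v ∧ b ≠ v ∧ H.Reachable a b ∧ ¬ (del H {v}).Reachable a b

/-- `H` is non-separable: connected without cut-vertices. -/
def Nonseparable (H : SimpleGraph W) : Prop := H.Connected ∧ ∀ v : W, ¬ IsCutVert H v

/-- `B` is the vertex set of a block of `H`: a maximal set inducing a non-separable graph. -/
def IsBlockSet (H : SimpleGraph W) (B : Set W) : Prop :=
  Nonseparable (H.induce B) ∧ ∀ B' : Set W, B ⊆ B' → Nonseparable (H.induce B') → B' = B

/-- An end-block: a block containing at most one cut-vertex of `H`. -/
def IsEndBlock (H : SimpleGraph W) (B : Set W) : Prop :=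
  IsBlockSet H B ∧ {v ∈ B | IsCutVert H v}.encard ≤ 1

/-- A block-chain: a connected graph whose block-cut tree is a path, i.e. every block
contains at most two cut-vertices and every cut-vertex lies in at most two blocks. -/
def IsBlockChain (H : SimpleGraph W) : Prop :=
  H.Connected ∧
  (∀ B : Set W, IsBlockSet H B → {v ∈ B | IsCutVert H v}.encard ≤ 2) ∧
  ∀ v : W, IsCutVert H v → {B : Set W | IsBlockSet H B ∧ v ∈ B}.encard ≤ 2

/-- A block-chain connecting `u` and `v`: either `H` is non-separable, or `H` is separable
and `u`, `v` are non-cut vertices of two distinct end-blocks. -/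
def BlockChainConn (H : SimpleGraph W) (u v : W) : Prop :=
  IsBlockChain H ∧
  (Nonseparable H ∨
    ((∃ x, IsCutVert H x) ∧
      ∃ B₁ B₂ : Set W, IsEndBlock H B₁ ∧ IsEndBlock H B₂ ∧ B₁ ≠ B₂ ∧
        u ∈ B₁ ∧ v ∈ B₂ ∧ ¬ IsCutVert H u ∧ ¬ IsCutVert H v))

/-- The `k`-th power of `G`: vertices at distance at most `k` become adjacent. -/
def gpow (G : SimpleGraph V) (k : ℕ) : SimpleGraph V where
  Adj u v := u ≠ v ∧ ∃ p : G.Walk u v, p.length ≤ k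
  symm := ⟨fun u v h => ⟨h.1.symm, by obtain ⟨p, hp⟩ := h.2; exact ⟨p.reverse, by simpa using hp⟩⟩⟩
  loopless := ⟨fun v h => h.1 rfl⟩

/-- The copy `G × {d₀}` of `G` inside the Cartesian product `G □ D`. -/
def copyAt (G : SimpleGraph V) (d₀ : W) : SimpleGraph (V × W) where
  Adj p q := G.Adj p.1 q.1 ∧ p.2 = d₀ ∧ q.2 = d₀
  symm := ⟨fun p q h => ⟨h.1.symm, h.2.2, h.2.1⟩⟩
  loopless := ⟨fun p h => G.loopless.irrefl _ h.1⟩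

/-- The line graph of the subgraph `F` of `G`, presented on the vertex set `E(G)` of the
line graph of `G` (edges of `G` not in `F` are isolated). -/
def lineSub (G F : SimpleGraph V) : SimpleGraph G.edgeSet where
  Adj e f := (e : Sym2 V) ∈ F.edgeSet ∧ (f : Sym2 V) ∈ F.edgeSet ∧ e ≠ f ∧
    ∃ x : V, x ∈ (e : Sym2 V) ∧ x ∈ (f : Sym2 V)
  symm := ⟨fun e f h =>
    ⟨h.2.1, h.1, h.2.2.1.symm, by obtain ⟨x, h1, h2⟩ := h.2.2.2; exact ⟨x, h2, h1⟩⟩⟩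
  loopless := ⟨fun e h => h.2.2.1 rfl⟩

/-- `B ⊆ V(G)` induces a cycle of `G`. -/
def IsCycleSet (G : SimpleGraph V) (B : Set V) : Prop :=
  B.Finite ∧ B.Nonempty ∧ (G.induce B).Connected ∧
    ∀ v ∈ B, (G.neighborSet v ∩ B).ncard = 2

theorem del_mono {F G : SimpleGraph V} (h : F ≤ G) (S : Set V) : del F S ≤ del G S :=
  fun _ _ hab => ⟨h hab.1, hab.2⟩

theorem IsRay.mono {F G : SimpleGraph V} (h : F ≤ G) {R : ℕ → V} (hR : IsRay F R) :
    IsRay G R :=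
  ⟨hR.1, fun n => h (hR.2 n)⟩

theorem RayEquiv.mono {F G : SimpleGraph V} (h : F ≤ G) {R₁ R₂ : ℕ → V}
    (hR : RayEquiv F R₁ R₂) : RayEquiv G R₁ R₂ := fun S hS =>
  let ⟨m, n, hm, hn, hmn⟩ := hR S hS
  ⟨m, n, hm, hn, hmn.mono (del_mono h S)⟩

theorem RayEquiv.symm {G : SimpleGraph V} {R₁ R₂ : ℕ → V} (h : RayEquiv G R₁ R₂) :
    RayEquiv G R₂ R₁ := fun S hS =>
  let ⟨m, n, hm, hn, hmn⟩ := h S hS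
  ⟨n, m, hn, hm, hmn.symm⟩

/-- Later vertices of a ray stay in the component of `G − S` that contains a tail. -/
theorem IsRay.reachable_del {G : SimpleGraph V} {R : ℕ → V} (hR : IsRay G R) {S : Set V}
    {m n : ℕ} (hm : ∀ i, m ≤ i → R i ∉ S) (hmn : m ≤ n) :
    (del G S).Reachable (R m) (R n) := by
  induction n, hmn using Nat.le_induction with
  | base => exact Reachable.refl _
  | succ k hk ih =>
    have hadj : (del G S).Adj (R k) (R (k + 1)) :=
      ⟨hR.2 k, hm k hk, hm (k + 1) (hk.trans k.le_succ)⟩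
    exact ih.trans hadj.reachable

theorem RayEquiv.trans {G : SimpleGraph V} {R₁ R₂ R₃ : ℕ → V} (hR₂ : IsRay G R₂)
    (h₁₂ : RayEquiv G R₁ R₂) (h₂₃ : RayEquiv G R₂ R₃) : RayEquiv G R₁ R₃ := by
  intro S hS
  obtain ⟨m, n, hm, hn, hmn⟩ := h₁₂ S hS
  obtain ⟨k, l, hk, hl, hkl⟩ := h₂₃ S hS
  refine ⟨m, l, hm, hl, hmn.trans (Reachable.trans ?_ hkl)⟩
  rcases le_total n k with hnk | hkn
  · exact hR₂.reachable_del hn hnk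
  · exact (hR₂.reachable_del hk hkn).symm

theorem Faithful.trans {D F G : SimpleGraph V} (hDF : D ≤ F) (hFG : F ≤ G)
    (h₁ : Faithful D F) (h₂ : Faithful F G) : Faithful D G := by
  refine ⟨fun R hR => ?_, fun R₁ R₂ hR₁ hR₂ =>
    (h₁.2 R₁ R₂ hR₁ hR₂).trans (h₂.2 R₁ R₂ (hR₁.mono hDF) (hR₂.mono hDF))⟩
  obtain ⟨R', hR', hRR'⟩ := h₂.1 R hR
  obtain ⟨R'', hR'', hRR''⟩ := h₁.1 R' hR'
  exact ⟨R'', hR'', hRR'.trans (hR'.mono hFG) (hRR''.mono hFG)⟩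

theorem Faithful.of_faithful_left {D F G : SimpleGraph V} (hDF : D ≤ F) (hFG : F ≤ G)
    (h₁ : Faithful D F) (h₃ : Faithful D G) : Faithful F G := by
  refine ⟨fun R hR => ?_, fun R₁ R₂ hR₁ hR₂ => ⟨RayEquiv.mono hFG, fun h => ?_⟩⟩
  · obtain ⟨R', hR', hRR'⟩ := h₃.1 R hR
    exact ⟨R', hR'.mono hDF, hRR'⟩
  · obtain ⟨Q₁, hQ₁, e₁⟩ := h₁.1 R₁ hR₁
    obtain ⟨Q₂, hQ₂, e₂⟩ := h₁.1 R₂ hR₂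
    have hG : RayEquiv G Q₁ Q₂ :=
      ((e₁.mono hFG).symm.trans (hR₁.mono hFG) h).trans (hR₂.mono hFG) (e₂.mono hFG)
    have hF : RayEquiv F Q₁ Q₂ := ((h₃.2 Q₁ Q₂ hQ₁ hQ₂).2 hG).mono hDF
    exact (e₁.trans (hQ₁.mono hDF) hF).trans (hQ₂.mono hDF) e₂.symm

theorem Faithful.of_faithful_right {D F G : SimpleGraph V} (hDF : D ≤ F) (hFG : F ≤ G)
    (h₂ : Faithful F G) (h₃ : Faithful D G) : Faithful D F := by
  refine ⟨fun R hR => ?_, fun R₁ R₂ hR₁ hR₂ =>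
    (h₃.2 R₁ R₂ hR₁ hR₂).trans (h₂.2 R₁ R₂ (hR₁.mono hDF) (hR₂.mono hDF)).symm⟩
  obtain ⟨R', hR', hRR'⟩ := h₃.1 R (hR.mono hFG)
  exact ⟨R', hR', (h₂.2 R R' hR (hR'.mono hDF)).2 hRR'⟩

/-- For `G` infinite, locally finite and connected, with `F` a faithful
spanning subgraph of `G` and `D ≤ F`, any two of (1) `D` faithful to `F`,
(2) `F` faithful to `G`, (3) `D` faithful to `G` imply the third. -/
theorem faithful_two_of_three {V : Type u} (G : SimpleGraph V)
    (hinf : Infinite V) (hlf : LocFin G) (hconn : G.Connected)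
    (F : G.Subgraph) (hFspan : F.IsSpanning) (hFfaith : Faithful F.spanningCoe G)
    (D : G.Subgraph) (hDF : D ≤ F) :
    ((Faithful D.spanningCoe F.spanningCoe ∧ Faithful F.spanningCoe G) →
        Faithful D.spanningCoe G) ∧
    ((Faithful D.spanningCoe F.spanningCoe ∧ Faithful D.spanningCoe G) →
        Faithful F.spanningCoe G) ∧
    ((Faithful F.spanningCoe G ∧ Faithful D.spanningCoe G) →
        Faithful D.spanningCoe F.spanningCoe) := by
  have hDF' : D.spanningCoe ≤ F.spanningCoe := fun _ _ h => hDF.2 h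
  have hFG : F.spanningCoe ≤ G := F.spanningCoe_le
  exact ⟨fun h => h.1.trans hDF' hFG h.2, fun h => h.1.of_faithful_left hDF' hFG h.2,
    fun h => h.1.of_faithful_right hDF' hFG h.2⟩

end IGraph
end

section
/- Let G be an infinite locally finite connected graph and let D be a connected spanning subgraph of G that is faithful to G. Then for every graph F with D ≤ F ≤ G (D a subgraph of F, F a subgraph of G), D is faithful to F and F is faithful to G. -/
namespace IGraph

open SimpleGraph

universe u w

variable {V : Type u} {W : Type w}

theorem IsRay.exists_tail_notMem {G : SimpleGraph V} {R : ℕ → V} (hR : IsRay G R) {S : Set V}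
    (hS : S.Finite) : ∃ m, ∀ i, m ≤ i → R i ∉ S := by
  obtain ⟨b, hb⟩ := (hS.preimage hR.1.injOn).bddAbove
  exact ⟨b + 1, fun i hi hiS => by have : i ≤ b := hb hiS; omega⟩

/-- `y` is a neighbour of `x` one step further from the root `v`. -/
def StepAway (D : SimpleGraph V) (v x y : V) : Prop := D.Adj x y ∧ D.dist v y = D.dist v x + 1

theorem reflTransGen_stepAway_root {D : SimpleGraph V} (hD : D.Connected) (v u : V) :
    Relation.ReflTransGen (StepAway D v) v u := by
  induction hn : D.dist v u generalizing u with
  | zero =>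
    rw [hD.dist_eq_zero_iff] at hn
    exact hn ▸ .refl
  | succ n ih =>
    obtain ⟨p, hp⟩ := hD.exists_walk_length_eq_dist u v
    rw [dist_comm, hn] at hp
    cases p with
    | nil => simp at hp
    | @cons _ w _ h q =>
      have hle : D.dist v w ≤ n := by
        rw [dist_comm]
        exact (dist_le q).trans (by simpa using hp.le)
      have htri : D.dist v u ≤ D.dist v w + D.dist w u := hD.dist_triangle
      rw [dist_eq_one_iff_adj.mpr h.symm] at htri
      exact (ih w (by omega)).tail ⟨h.symm, by omega⟩

theorem reachable_del_of_stepAway {D : SimpleGraph V} {v x u : V} {S : Set V}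
    (hxu : Relation.ReflTransGen (StepAway D v) x u)
    (hS : ∀ s ∈ S, D.dist v s < D.dist v x) : (del D S).Reachable x u := by
  induction hxu using Relation.ReflTransGen.head_induction_on with
  | refl => exact Reachable.refl _
  | @head a c hac _ ih =>
    have hlt : D.dist v a < D.dist v c := by have := hac.2; omega
    have hadj : (del D S).Adj a c :=
      ⟨hac.1, fun h => (hS a h).false, fun h => absurd (hS c h) hlt.not_gt⟩
    exact hadj.reachable.trans (ih fun s hs => (hS s hs).trans hlt)

theorem exists_stepAway_infinite {D : SimpleGraph V} (hlf : LocFin D) {R : ℕ → V}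
    (hR : Function.Injective R) {v x : V}
    (hx : {m | Relation.ReflTransGen (StepAway D v) x (R m)}.Infinite) :
    ∃ y, StepAway D v x y ∧ {m | Relation.ReflTransGen (StepAway D v) y (R m)}.Infinite := by
  by_contra! hfin
  have hsteps : {y | StepAway D v x y}.Finite := (hlf x).subset fun y hy => hy.1
  have hunion := hsteps.biUnion hfin
  refine hx ((((Set.finite_singleton x).preimage hR.injOn).union hunion).subset fun m hm => ?_)
  rcases Relation.ReflTransGen.cases_head hm with h | ⟨y, hxy, hy⟩
  · exact Or.inl h.symm
  · exact Or.inr (Set.mem_biUnion hxy hy)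

/-- Every ray of a graph `F` is equivalent in `F` to a ray of any given connected locally finite
spanning subgraph `D`. -/
theorem IsRay.exists_rayEquiv_of_connected_spanning {D F : SimpleGraph V} (hlf : LocFin D)
    (hD : D.Connected) (hDF : D ≤ F) {R : ℕ → V} (hR : IsRay F R) :
    ∃ R', IsRay D R' ∧ RayEquiv F R R' := by
  let v := R 0
  let P : V → Prop := fun x => {m | Relation.ReflTransGen (StepAway D v) x (R m)}.Infinite
  have hroot : P v := by
    have huniv : {m | Relation.ReflTransGen (StepAway D v) v (R m)} = Set.univ :=
      Set.eq_univ_of_forall fun m => reflTransGen_stepAway_root hD v (R m)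
    simpa only [P, huniv] using Set.infinite_univ
  have hnext : ∀ x : {x // P x}, ∃ y : {y // P y}, StepAway D v x y := fun x => by
    obtain ⟨y, hxy, hy⟩ := exists_stepAway_infinite hlf hR.1 x.2
    exact ⟨⟨y, hy⟩, hxy⟩
  choose next hstep using hnext
  let T : ℕ → {x // P x} := fun n => next^[n] ⟨v, hroot⟩
  have hT : ∀ n, StepAway D v (T n) (T (n + 1)) := fun n => by
    simpa only [T, Function.iterate_succ_apply'] using hstep (T n)
  have hdist : ∀ n, D.dist v (T n) = n := fun n => by
    induction n with
    | zero => exact dist_self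
    | succ n ih => rw [(hT n).2, ih]
  refine ⟨fun n => T n, ⟨fun a b hab => ?_, fun n => (hT n).1⟩, fun S hS => ?_⟩
  · rw [← hdist a, ← hdist b]
    exact congrArg (D.dist v) hab
  · obtain ⟨b, hb⟩ := (hS.image (D.dist v)).bddAbove
    have hlt : ∀ s ∈ S, D.dist v s < b + 1 := fun s hs =>
      Nat.lt_succ_of_le (hb (Set.mem_image_of_mem _ hs))
    obtain ⟨m₀, hm₀⟩ := hR.exists_tail_notMem hS
    obtain ⟨m, hm, hmm⟩ := (T (b + 1)).2.exists_gt m₀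
    refine ⟨m, b + 1, fun i hi => hm₀ i (hmm.le.trans hi), fun j hj hjS => ?_, ?_⟩
    · have := hlt _ hjS
      rw [hdist] at this
      omega
    · refine Reachable.mono (del_mono hDF S) (reachable_del_of_stepAway hm fun s hs => ?_).symm
      rw [hdist]
      exact hlt s hs

/-- If `D` is a connected spanning subgraph of the infinite locally finite
connected graph `G` that is faithful to `G`, then for every `F` with `D ≤ F ≤ G`,
`D` is faithful to `F` and `F` is faithful to `G`. -/
theorem faithful_of_connected_spanning {V : Type u} (G D : SimpleGraph V)
    (hinf : Infinite V) (hlf : LocFin G) (hconn : G.Connected)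
    (hDG : D ≤ G) (hDconn : D.Connected) (hDfaith : Faithful D G) :
    ∀ F : SimpleGraph V, D ≤ F → F ≤ G → Faithful D F ∧ Faithful F G := by
  intro F hDF hFG
  have hlfD : LocFin D := fun v => (hlf v).subset fun _ h => hDG h
  refine ⟨⟨fun R hR => hR.exists_rayEquiv_of_connected_spanning hlfD hDconn hDF,
    fun R₁ R₂ h₁ h₂ => ⟨RayEquiv.mono hDF, fun h => (hDfaith.2 R₁ R₂ h₁ h₂).mpr (h.mono hFG)⟩⟩,
    fun R hR => ?_, fun R₁ R₂ h₁ h₂ => ⟨RayEquiv.mono hFG, fun h => ?_⟩⟩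
  · obtain ⟨R', hR', hRR'⟩ := hDfaith.1 R hR
    exact ⟨R', hR'.mono hDF, hRR'⟩
  · obtain ⟨Q₁, hQ₁, e₁⟩ := h₁.exists_rayEquiv_of_connected_spanning hlfD hDconn hDF
    obtain ⟨Q₂, hQ₂, e₂⟩ := h₂.exists_rayEquiv_of_connected_spanning hlfD hDconn hDF
    have hG : RayEquiv G Q₁ Q₂ :=
      ((e₁.mono hFG).symm.trans (h₁.mono hFG) h).trans (h₂.mono hFG) (e₂.mono hFG)
    have hF : RayEquiv F Q₁ Q₂ := ((hDfaith.2 Q₁ Q₂ hQ₁ hQ₂).mpr hG).mono hDF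
    exact e₁.trans (hQ₁.mono hDF) (hF.trans (hQ₂.mono hDF) e₂.symm)

end IGraph
end

section
/- Let G be an infinite locally finite connected graph, α an end of G, and k a positive integer. Then the following are equivalent: (1) d(α) ≤ k; (2) for every finite S ⊆ V(G) there is a finite T ⊆ V(G) with S ⊆ T such that |Z_G(C(T,α))| ≤ k; (3) for every finite S ⊆ V(G) there is a finite T ⊆ V(G) with S ⊆ T such that |N_G(C(T,α))| ≤ k. -/
namespace IGraph

open SimpleGraph

universe u w

variable {V : Type u} {W : Type w}

/-- A vertex reached in `G − T` from a vertex outside `T` lies outside `T`. -/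
theorem notMem_of_mem_compOf {G : SimpleGraph V} {T : Set V} {v x : V} (hv : v ∉ T)
    (hx : x ∈ compOf G T v) : x ∉ T := by
  have h := (SimpleGraph.reachable_iff_reflTransGen v x).1 hx
  cases h with
  | refl => exact hv
  | tail _ h => exact h.2.2

theorem mem_compOf_of_adj {G : SimpleGraph V} {T : Set V} {v x y : V} (hv : v ∉ T)
    (hx : x ∈ compOf G T v) (hxy : G.Adj x y) (hy : y ∉ T) : y ∈ compOf G T v :=
  SimpleGraph.Reachable.trans hx
    (SimpleGraph.Adj.reachable (G := del G T) ⟨hxy, notMem_of_mem_compOf hv hx, hy⟩)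

theorem NSet_compOf_subset {G : SimpleGraph V} {T : Set V} {v : V} (hv : v ∉ T) :
    NSet G (compOf G T v) ⊆ T := by
  rintro y ⟨hy, x, hx, hxy⟩
  by_contra hyT
  exact hy (mem_compOf_of_adj hv hx hxy hyT)

/-- A component of `G − T` meeting `Q` is contained in `Q` as soon as `N_G(Q) ⊆ T`. -/
theorem compOf_subset {G : SimpleGraph V} {T Q : Set V} {v : V} (hv : v ∈ Q)
    (hQ : NSet G Q ⊆ T) : compOf G T v ⊆ Q := by
  intro x hx
  have h := (SimpleGraph.reachable_iff_reflTransGen v x).1 hx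
  induction h with
  | refl => exact hv
  | tail h₁ h₂ ih =>
    by_contra hc
    exact h₂.2.2 (hQ ⟨hc, _, ih ((SimpleGraph.reachable_iff_reflTransGen _ _).2 h₁), h₂.1⟩)

theorem compOf_subset_compOf_of_disjoint {G : SimpleGraph V} {S T : Set V} {v : V}
    (h : Disjoint (compOf G T v) S) : compOf G T v ⊆ compOf G S v := by
  intro x hx
  have h' := (SimpleGraph.reachable_iff_reflTransGen v x).1 hx
  induction h' with
  | refl => exact SimpleGraph.Reachable.refl _
  | tail h₁ h₂ ih =>
    have hb := (SimpleGraph.reachable_iff_reflTransGen _ _).2 h₁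
    exact (ih hb).trans (SimpleGraph.Adj.reachable (G := del G S)
      ⟨h₂.1, Set.disjoint_left.1 h hb, Set.disjoint_left.1 h hx⟩)

theorem IsRay.mem_compOf {G : SimpleGraph V} {R : ℕ → V} (hR : IsRay G R) {T : Set V} {m : ℕ}
    (hm : ∀ i, m ≤ i → R i ∉ T) {i : ℕ} (hi : m ≤ i) : R i ∈ compOf G T (R m) := by
  induction i, hi using Nat.le_induction with
  | base => exact SimpleGraph.Reachable.refl _
  | succ n hn ih =>
    exact mem_compOf_of_adj (hm m le_rfl) ih (hR.2 n) (hm _ (by omega))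

theorem exists_forall_notMem_of_injective {R : ℕ → V} (hR : Function.Injective R) {S : Set V}
    (hS : S.Finite) : ∃ m : ℕ, ∀ i, m ≤ i → R i ∉ S := by
  obtain ⟨m, hm⟩ := (hS.preimage hR.injOn).bddAbove
  exact ⟨m + 1, fun i hi h => by have := hm (show i ∈ R ⁻¹' S from h); omega⟩

theorem finite_ZSet {G : SimpleGraph V} (hlf : LocFin G) {X : Set V} (hX : (NSet G X).Finite) :
    (ZSet G X).Finite := by
  refine (hX.biUnion fun y _ => hlf y).subset ?_
  rintro x ⟨hx, y, hy, hxy⟩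
  exact Set.mem_biUnion (show y ∈ NSet G X from ⟨hy, x, hx, hxy⟩) hxy.symm

/-- A sequence of vertices that starts outside `X` and visits `X` crosses
from outside `X` into `X`. -/
theorem exists_crossing {X : Set V} {f : ℕ → V} (h0 : f 0 ∉ X) {n : ℕ} (hn : f n ∈ X) :
    ∃ j, f j ∉ X ∧ f (j + 1) ∈ X := by
  induction n with
  | zero => exact absurd hn h0
  | succ n ih =>
    by_cases h : f n ∈ X
    · exact ih h
    · exact ⟨n, h, hn⟩

/-- Boundaries (inner or outer) of the components `C(T, α)` bound the end degree. -/
theorem endDegree_le_of_boundary {G : SimpleGraph V} {R : ℕ → V} (hR : IsRay G R) {k : ℕ}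
    (B : Set V → Set V)
    (hB : ∀ X x y, x ∉ X → y ∈ X → G.Adj x y → x ∈ B X ∨ y ∈ B X)
    (h : ∀ S : Set V, S.Finite → ∃ T : Set V, T.Finite ∧ S ⊆ T ∧
      ∃ m : ℕ, (∀ i, m ≤ i → R i ∉ T) ∧ (B (compOf G T (R m))).encard ≤ (k : ℕ∞)) :
    endDegree G R ≤ k := by
  refine iSup₂_le ?_
  rintro n ⟨f, hf, hdisj⟩
  obtain ⟨T, hT, hST, m, hm, hk⟩ := h (Set.range fun i => f i 0) (Set.finite_range _)
  set C := compOf G T (R m) with hC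
  have key : ∀ i, ∃ j, f i j ∈ B C := by
    intro i
    have h0 : f i 0 ∉ C := fun hx =>
      notMem_of_mem_compOf (hm m le_rfl) hx (hST ⟨i, rfl⟩)
    obtain ⟨a, b, -, hb, hab⟩ := (hf i).2 T hT
    have hin : f i a ∈ C := by
      have h₁ : R (max m b) ∈ compOf G T (R b) := hR.mem_compOf hb (le_max_right _ _)
      have h₂ : R (max m b) ∈ C := hR.mem_compOf hm (le_max_left _ _)
      exact (SimpleGraph.Reachable.trans h₂ h₁.symm).trans hab.symm
    obtain ⟨j, hj, hj'⟩ := exists_crossing h0 hin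
    rcases hB C _ _ hj hj' ((hf i).1.2 j) with h | h
    exacts [⟨_, h⟩, ⟨_, h⟩]
  choose j hj using key
  have hinj : Function.Injective fun i => f i (j i) := by
    intro a b hab
    by_contra hne
    exact Set.disjoint_left.1 (hdisj a b hne) ⟨j a, rfl⟩ ⟨j b, hab.symm⟩
  calc (n : ℕ∞) = (Set.range fun i => f i (j i)).encard := by
        rw [← Set.image_univ, hinj.injOn.encard_image]; simp
    _ ≤ (B C).encard := Set.encard_le_encard (by rintro _ ⟨i, rfl⟩; exact hj i)
    _ ≤ k := hk

/-- Hall's theorem for a finite set of vertices. -/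
theorem exists_injOn_of_hall [DecidableEq V] (P : Finset V) (t : V → Finset V)
    (h : ∀ F ⊆ P, F.card ≤ (F.biUnion t).card) :
    ∃ g : V → V, Set.InjOn g P ∧ ∀ v ∈ P, g v ∈ t v := by
  classical
  have hall : ∀ s : Finset P, s.card ≤ (s.biUnion fun v => t v).card := by
    intro s
    have := h (s.map (Function.Embedding.subtype _)) (by
      intro x hx
      obtain ⟨y, -, rfl⟩ := Finset.mem_map.1 hx
      exact y.2)
    rw [Finset.card_map, Finset.map_eq_image, Finset.image_biUnion] at this
    exact this
  obtain ⟨f, hf, hft⟩ := (Finset.all_card_le_biUnion_card_iff_exists_injective _).1 hall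
  refine ⟨fun v => if hv : v ∈ P then f ⟨v, hv⟩ else v, ?_, ?_⟩
  · intro a ha b hb hab
    have ha' : a ∈ P := ha
    have hb' : b ∈ P := hb
    simp only [ha', hb', dif_pos] at hab
    simpa using hf hab
  · intro v hv
    simp only [hv, dif_pos]
    exact hft ⟨v, hv⟩

/-- The limit of sets of size at most `n` along an ultrafilter has size at most `n`. -/
theorem encard_ultrafilter_limit_le {ι : Type*} (U : Ultrafilter ι) (s : ι → Finset V) {n : ℕ}
    (hs : ∀ i, (s i).card ≤ n) : {v | ∀ᶠ i in (U : Filter ι), v ∈ s i}.encard ≤ n := by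
  by_contra! hlt
  obtain ⟨F, hF, hFn⟩ := Set.exists_subset_encard_eq (Order.add_one_le_of_lt hlt)
  have hfin : F.Finite := Set.finite_of_encard_eq_coe (k := n + 1) (by simpa using hFn)
  have hev : ∀ᶠ i in (U : Filter ι), ∀ v ∈ F, v ∈ s i :=
    (Filter.eventually_all_finite hfin).2 fun v hv => hF hv
  obtain ⟨i, hi⟩ := hev.exists
  have h₁ : F.encard ≤ (s i : Set V).encard := Set.encard_le_encard hi
  rw [hFn, Set.encard_coe_eq_coe_finsetCard] at h₁
  have h₂ : n + 1 ≤ (s i).card := by exact_mod_cast h₁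
  have := hs i
  omega

/-- A Menger-type statement: if `N_G(X)` is a smallest boundary among sets between `Y` and `X`,
then it is linked to `N_G(Y)` by disjoint paths inside a finite set `D`. The paths are encoded by
an injective successor function. -/
theorem exists_linking (G : SimpleGraph V) {X Y : Set V} {A : Finset V} (hA : NSet G X = A)
    (hYX : Y ⊆ X)
    (hmin : ∀ Q, Y ⊆ Q → Q ⊆ X → (A.card : ℕ∞) ≤ (NSet G Q).encard) :
    ∃ D : Finset V, A ⊆ D ∧ (∀ v ∈ D, (v ∈ A ∨ v ∈ X) ∧ v ∉ Y) ∧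
      ∃ g : V → V, Set.InjOn g (D \ NSet G Y) ∧
        ∀ v ∈ D, v ∉ NSet G Y → g v ∈ D ∧ g v ∉ A ∧ (g v = v ∨ G.Adj v (g v)) := by
  classical
  have hAX : ∀ a ∈ A, a ∉ X := fun a ha => by
    have : a ∈ NSet G X := by rw [hA]; exact ha
    exact this.1
  by_contra hcon
  let D : Finset V → Finset V := fun s => (s ∪ A).filter fun v => (v ∈ A ∨ v ∈ X) ∧ v ∉ Y
  have hAD : ∀ s, A ⊆ D s := fun s a ha =>
    Finset.mem_filter.2 ⟨Finset.mem_union_right _ ha, .inl ha, fun h => hAX a ha (hYX h)⟩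
  let t : Finset V → V → Finset V := fun s v => {u ∈ D s | (u = v ∨ G.Adj v u) ∧ u ∉ A}
  have hviol : ∀ s, ∃ F ⊆ {v ∈ D s | v ∉ NSet G Y}, (F.biUnion (t s)).card < F.card := by
    intro s
    by_contra! hno
    obtain ⟨g, hg, hgt⟩ := exists_injOn_of_hall _ (t s) hno
    refine hcon ⟨D s, hAD s, fun v hv => (Finset.mem_filter.1 hv).2, g, ?_, ?_⟩
    · refine hg.mono fun v hv => ?_
      exact Finset.mem_coe.2 (Finset.mem_filter.2 hv)
    · intro v hv hvY
      have := Finset.mem_filter.1 (hgt v (Finset.mem_filter.2 ⟨hv, hvY⟩))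
      exact ⟨this.1, this.2.2, this.2.1⟩
  choose F hFD hFcard using hviol
  have hFself : ∀ s, F s \ A ⊆ (F s).biUnion (t s) := by
    intro s v hv
    obtain ⟨hvF, hvA⟩ := Finset.mem_sdiff.1 hv
    exact Finset.mem_biUnion.2 ⟨v, hvF,
      Finset.mem_filter.2 ⟨(Finset.mem_filter.1 (hFD s hvF)).1, .inl rfl, hvA⟩⟩
  let sep : Finset V → Finset V := fun s => (A \ F s) ∪ ((F s).biUnion (t s) \ (F s \ A))
  have hsep : ∀ s, (sep s).card + 1 ≤ A.card := by
    intro s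
    have h₁ : (sep s).card ≤ _ := Finset.card_union_le _ _
    have h₂ := Finset.card_sdiff_add_card_eq_card (hFself s)
    have h₃ := Finset.card_sdiff_add_card_inter A (F s)
    have h₄ := Finset.card_sdiff_add_card_inter (F s) A
    rw [Finset.inter_comm] at h₄
    have := hFcard s
    omega
  let U : Ultrafilter (Finset V) := Ultrafilter.of Filter.atTop
  have hU : (U : Filter (Finset V)) ≤ Filter.atTop := Ultrafilter.of_le _
  let L : Set V := {v | ∀ᶠ s in (U : Filter (Finset V)), v ∈ F s}
  have hLY : ∀ w ∈ L, w ∉ Y ∧ w ∉ NSet G Y := by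
    intro w hw
    obtain ⟨s, hs⟩ := hw.exists
    have := Finset.mem_filter.1 (hFD s hs)
    exact ⟨(Finset.mem_filter.1 this.1).2.2, this.2⟩
  let Q : Set V := {v ∈ X | v ∉ L ∧ ∀ w ∈ L, ¬ G.Adj w v}
  have hYQ : Y ⊆ Q := fun y hy => ⟨hYX hy, fun h => (hLY y h).1 hy, fun w hw hwy =>
    (hLY w hw).2 ⟨(hLY w hw).1, y, hy, hwy.symm⟩⟩
  have hNQ : NSet G Q ⊆ {v | ∀ᶠ s in (U : Filter (Finset V)), v ∈ sep s} := by
    rintro v ⟨hvQ, x, hxQ, hxv⟩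
    have hvL : ∀ᶠ s in (U : Filter (Finset V)), v ∉ F s :=
      Ultrafilter.eventually_not.2 fun h => hxQ.2.2 v h hxv.symm
    by_cases hvX : v ∈ X
    · have hvY : v ∉ Y := fun h => hvQ (hYQ h)
      obtain ⟨w, hw, hwv⟩ : ∃ w ∈ L, G.Adj w v := by
        by_contra! hno
        exact hvQ ⟨hvX, Ultrafilter.eventually_not.1 hvL, hno⟩
      have hin : ∀ᶠ s in (U : Filter (Finset V)), v ∈ s :=
        hU ((Filter.eventually_ge_atTop {v}).mono fun s hs => hs (Finset.mem_singleton_self v))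
      filter_upwards [hvL, hw, hin] with s h₁ h₂ h₃
      refine Finset.mem_union_right _ (Finset.mem_sdiff.2 ⟨Finset.mem_biUnion.2 ⟨w, h₂,
        Finset.mem_filter.2 ⟨Finset.mem_filter.2 ⟨Finset.mem_union_left _ h₃, .inr hvX, hvY⟩,
          .inr hwv, fun h => hAX v h hvX⟩⟩, fun h => h₁ (Finset.mem_sdiff.1 h).1⟩)
    · have hvA : v ∈ A := by
        have : v ∈ NSet G X := ⟨hvX, x, hxQ.1, hxv⟩
        rw [hA] at this
        exact this
      filter_upwards [hvL] with s h₁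
      exact Finset.mem_union_left _ (Finset.mem_sdiff.2 ⟨hvA, h₁⟩)
  have h₁ := hmin Q hYQ fun v hv => hv.1
  have h₂ := encard_ultrafilter_limit_le U sep (n := A.card - 1)
    fun s => by have := hsep s; omega
  have h₃ : A.card ≤ A.card - 1 := by
    exact_mod_cast h₁.trans ((Set.encard_le_encard hNQ).trans h₂)
  have := hsep ∅
  omega

/-- A set containing a tail of `R` contains a component `C(T, α)` with no larger boundary. -/
theorem exists_compOf_subset {G : SimpleGraph V} {R : ℕ → V} {S Q : Set V}
    (hQS : Disjoint Q S) {n : ℕ} (hn : ∀ i, n ≤ i → R i ∈ Q) :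
    (∀ i, n ≤ i → R i ∉ S ∪ NSet G Q) ∧ compOf G (S ∪ NSet G Q) (R n) ⊆ Q ∧
      NSet G (compOf G (S ∪ NSet G Q) (R n)) ⊆ NSet G Q := by
  have hav : ∀ i, n ≤ i → R i ∉ S ∪ NSet G Q := by
    rintro i hi (h | h)
    · exact Set.disjoint_left.1 hQS (hn i hi) h
    · exact h.1 (hn i hi)
  have hsub : compOf G (S ∪ NSet G Q) (R n) ⊆ Q :=
    compOf_subset (hn n le_rfl) Set.subset_union_right
  refine ⟨hav, hsub, ?_⟩
  rintro y ⟨hy, x, hx, hxy⟩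
  refine ⟨fun hyQ => ?_, x, hsub hx, hxy⟩
  rcases NSet_compOf_subset (hav n le_rfl) ⟨hy, x, hx, hxy⟩ with h | h
  · exact Set.disjoint_left.1 hQS hyQ h
  · exact h.1 hyQ

/-- Among the sets avoiding `S` and containing a tail of `R`, one with smallest boundary can be
chosen of the form `C(T, α)`. -/
theorem exists_minimal_compOf {G : SimpleGraph V} {R : ℕ → V} (hR : IsRay G R) {S : Set V}
    (hS : S.Finite) :
    ∃ T : Set V, T.Finite ∧ S ⊆ T ∧ ∃ m : ℕ, (∀ i, m ≤ i → R i ∉ T) ∧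
      ∀ Q : Set V, Disjoint Q S → (∃ n : ℕ, ∀ i, n ≤ i → R i ∈ Q) →
        (NSet G (compOf G T (R m))).encard ≤ (NSet G Q).encard := by
  let P : Set (Set V) := {Q | Disjoint Q S ∧ ∃ n : ℕ, ∀ i, n ≤ i → R i ∈ Q}
  obtain ⟨m, hm⟩ := exists_forall_notMem_of_injective hR.1 hS
  have hP : compOf G S (R m) ∈ P :=
    ⟨Set.disjoint_left.2 fun x hx => notMem_of_mem_compOf (hm m le_rfl) hx, m,
      fun i hi => hR.mem_compOf hm hi⟩
  obtain ⟨_, ⟨Q, hQ, rfl⟩, hQmin⟩ := WellFounded.has_min (wellFounded_lt (α := ℕ∞))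
    ((fun Q => (NSet G Q).encard) '' P) ⟨_, _, hP, rfl⟩
  have hle : ∀ Q' ∈ P, (NSet G Q).encard ≤ (NSet G Q').encard := fun Q' hQ' =>
    not_lt.1 (hQmin _ ⟨Q', hQ', rfl⟩)
  have hfin : (NSet G Q).Finite := by
    have hfin' := hS.subset (NSet_compOf_subset (G := G) (hm m le_rfl))
    exact Set.encard_lt_top_iff.1 ((hle _ hP).trans_lt (Set.encard_lt_top_iff.2 hfin'))
  obtain ⟨hQS, n, hn⟩ := hQ
  obtain ⟨hav, -, hN⟩ := exists_compOf_subset (G := G) hQS hn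
  exact ⟨S ∪ NSet G Q, hS.union hfin, Set.subset_union_left, n, hav, fun Q' h₁ h₂ =>
    (Set.encard_le_encard hN).trans (hle Q' ⟨h₁, h₂⟩)⟩

/-- If a nested sequence of sets has finite boundaries, each smallest possible among the sets
between it and the next one, then every vertex of the first boundary starts a ray that eventually
lies in each of the sets, and these rays can be chosen pairwise disjoint. -/
theorem exists_disjoint_rays (G : SimpleGraph V) (X : ℕ → Set V) (A : ℕ → Finset V)
    (hA : ∀ n, NSet G (X n) = A n) (hX : ∀ n, X (n + 1) ⊆ X n)
    (hAX : ∀ n, ∀ v ∈ A (n + 1), v ∈ X n)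
    (hmin : ∀ n Q, X (n + 1) ⊆ Q → Q ⊆ X n → ((A n).card : ℕ∞) ≤ (NSet G Q).encard) :
    ∃ r : V → ℕ → V, (∀ a ∈ A 0, IsRay G (r a) ∧ ∀ n, ∃ m, ∀ i, m ≤ i → r a i ∈ X n) ∧
      ∀ a ∈ A 0, ∀ b ∈ A 0, a ≠ b → Disjoint (Set.range (r a)) (Set.range (r b)) := by
  classical
  choose D hAD hDX g hginj hg using fun n => exists_linking G (hA n) (hX n) (hmin n)
  have hanti : Antitone X := antitone_nat_of_succ_le hX
  have hA0 : ∀ v ∈ A 0, v ∉ X 0 := fun v hv => by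
    have : v ∈ NSet G (X 0) := by rw [hA]; exact hv
    exact this.1
  let E : ℕ → Set V := fun i => {v | v ∈ D i ∧ v ∉ NSet G (X (i + 1))}
  have hlow : ∀ {i j v}, i < j → v ∈ D j → v ∈ X i := by
    intro i j v hij hv
    rcases (hDX j v hv).1 with h | h
    · obtain ⟨j, rfl⟩ : ∃ j', j = j' + 1 := ⟨j - 1, by omega⟩
      exact hanti (by omega) (hAX j v h)
    · exact hanti hij.le h
  have hElt : ∀ {i j v}, i < j → v ∈ E i → v ∉ E j := by
    intro i j v hij hi hj
    rcases Nat.lt_or_ge (i + 1) j with h | h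
    · exact (hDX i v hi.1).2 (hlow h hj.1)
    · obtain rfl : j = i + 1 := by omega
      rcases (hDX _ v hj.1).1 with h | h
      · exact hi.2 (by rw [hA]; exact h)
      · exact (hDX i v hi.1).2 h
  have hEuniq : ∀ {i j v}, v ∈ E i → v ∈ E j → i = j := by
    intro i j v hi hj
    rcases lt_trichotomy i j with h | h | h
    exacts [absurd hj (hElt h hi), h, absurd hi (hElt h hj)]
  let s : V → V := fun v => if h : ∃ i, v ∈ E i then g h.choose v else v
  have hs : ∀ {i v}, v ∈ E i → s v = g i v := by
    intro i v hv
    have h : ∃ i, v ∈ E i := ⟨i, hv⟩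
    have hi : h.choose = i := hEuniq h.choose_spec hv
    simp only [s, dif_pos h, hi]
  have hsX : ∀ {i v}, v ∈ E i → s v ∈ X i ∧ s v ∉ X (i + 1) := by
    intro i v hv
    rw [hs hv]
    obtain ⟨h₁, h₂, -⟩ := hg i v hv.1 hv.2
    exact ⟨(hDX i _ h₁).1.resolve_left h₂, (hDX i _ h₁).2⟩
  have hsE : ∀ {i v}, v ∈ E i → ∃ j, s v ∈ E j := by
    intro i v hv
    have hD : s v ∈ D i := by rw [hs hv]; exact (hg i v hv.1 hv.2).1
    by_cases h : s v ∈ NSet G (X (i + 1))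
    · have hmem : s v ∈ A (i + 1) := by rw [hA] at h; exact h
      refine ⟨i + 1, hAD _ hmem, fun h' => h.1 ?_⟩
      rw [hA] at h'
      exact hAX _ _ h'
    · exact ⟨i, hD, h⟩
  have hsinj : ∀ {i j v w}, v ∈ E i → w ∈ E j → s v = s w → v = w := by
    intro i j v w hv hw hvw
    have hij : i = j := by
      have hv' := hsX hv
      have hw' := hsX hw
      rw [← hvw] at hw'
      rcases lt_trichotomy i j with h | h | h
      exacts [absurd (hanti h hw'.1) hv'.2, h, absurd (hanti h hv'.1) hw'.2]
    subst hij
    rw [hs hv, hs hw] at hvw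
    exact hginj i hv hw hvw
  have horb : ∀ a ∈ A 0, ∀ n, ∃ i, s^[n] a ∈ E i := by
    intro a ha n
    induction n with
    | zero =>
      refine ⟨0, hAD 0 ha, fun h => hA0 a ha ?_⟩
      rw [hA] at h
      exact hAX 0 a h
    | succ n ih =>
      obtain ⟨i, hi⟩ := ih
      rw [Function.iterate_succ_apply']
      exact hsE hi
  have hcancel : ∀ a ∈ A 0, ∀ b ∈ A 0, ∀ m n, s^[m] a = s^[n] b → a = b ∧ m = n := by
    have hstart : ∀ a ∈ A 0, ∀ b ∈ A 0, ∀ n, a ≠ s^[n + 1] b := by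
      intro a ha b hb n hab
      obtain ⟨i, hi⟩ := horb b hb n
      rw [Function.iterate_succ_apply'] at hab
      exact hA0 a ha (hab ▸ hanti (Nat.zero_le i) (hsX hi).1)
    intro a ha b hb m
    induction m with
    | zero =>
      rintro (_ | n) h
      · exact ⟨h, rfl⟩
      · exact absurd h (hstart a ha b hb n)
    | succ m ih =>
      rintro (_ | n) h
      · exact absurd h.symm (hstart b hb a ha m)
      · obtain ⟨i, hi⟩ := horb a ha m
        obtain ⟨j, hj⟩ := horb b hb n
        rw [Function.iterate_succ_apply', Function.iterate_succ_apply'] at h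
        obtain ⟨h₁, h₂⟩ := ih n (hsinj hi hj h)
        exact ⟨h₁, by rw [h₂]⟩
  have hinj : ∀ a ∈ A 0, Function.Injective fun n => s^[n] a := fun a ha m n h =>
    (hcancel a ha a ha m n h).2
  refine ⟨fun a n => s^[n] a, fun a ha => ⟨⟨hinj a ha, fun n => ?_⟩, fun n => ?_⟩, ?_⟩
  · obtain ⟨i, hi⟩ := horb a ha n
    have hne : s (s^[n] a) ≠ s^[n] a := by
      rw [← Function.iterate_succ_apply' s]
      exact fun h => absurd (hinj a ha h) (Nat.succ_ne_self n)
    simp only [Function.iterate_succ_apply']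
    have := (hg i _ hi.1 hi.2).2.2
    rw [← hs hi] at this
    exact this.resolve_left hne
  · obtain ⟨m, hm⟩ := exists_forall_notMem_of_injective (hinj a ha)
      (S := ⋃ i ∈ Set.Iic n, (D i : Set V))
      ((Set.finite_Iic n).biUnion fun i _ => (D i).finite_toSet)
    refine ⟨m, fun i hi => ?_⟩
    obtain ⟨j, hj⟩ := horb a ha i
    refine hlow (lt_of_not_ge fun hjn => hm i hi ?_) hj.1
    exact Set.mem_biUnion (show j ∈ Set.Iic n from hjn) hj.1
  · intro a ha b hb hab
    rw [Set.disjoint_left]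
    rintro _ ⟨m, rfl⟩ ⟨n, h⟩
    exact hab (hcancel b hb a ha n m h).1.symm

/-- `X` is a component `C(T, α)`, for the end `α` of `R` and some finite `T`, whose boundary is
smallest among the subsets of `X` containing a tail of `R`. -/
def IsTightComp (G : SimpleGraph V) (R : ℕ → V) (X : Set V) : Prop :=
  (∃ T : Set V, T.Finite ∧ ∃ m : ℕ, (∀ i, m ≤ i → R i ∉ T) ∧ X = compOf G T (R m)) ∧
    ∀ Q ⊆ X, (∃ n : ℕ, ∀ i, n ≤ i → R i ∈ Q) → (NSet G X).encard ≤ (NSet G Q).encard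

theorem IsTightComp.finite_NSet {G : SimpleGraph V} {R : ℕ → V} {X : Set V}
    (hX : IsTightComp G R X) : (NSet G X).Finite := by
  obtain ⟨⟨T, hT, m, hm, rfl⟩, -⟩ := hX
  exact hT.subset (NSet_compOf_subset (hm m le_rfl))

theorem IsTightComp.exists_tail {G : SimpleGraph V} {R : ℕ → V} (hR : IsRay G R) {X : Set V}
    (hX : IsTightComp G R X) : ∃ n : ℕ, ∀ i, n ≤ i → R i ∈ X := by
  obtain ⟨⟨T, hT, m, hm, rfl⟩, -⟩ := hX
  exact ⟨m, fun i hi => hR.mem_compOf hm hi⟩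

theorem exists_isTightComp {G : SimpleGraph V} {R : ℕ → V} (hR : IsRay G R) {S : Set V}
    (hS : S.Finite) :
    ∃ T : Set V, T.Finite ∧ S ⊆ T ∧ ∃ m : ℕ, (∀ i, m ≤ i → R i ∉ T) ∧
      IsTightComp G R (compOf G T (R m)) := by
  obtain ⟨T, hT, hST, m, hm, hmin⟩ := exists_minimal_compOf hR hS
  refine ⟨T, hT, hST, m, hm, ⟨T, hT, m, hm, rfl⟩, fun Q hQ hn => hmin Q ?_ hn⟩
  exact Set.disjoint_left.2 fun x hx hxS =>
    notMem_of_mem_compOf (hm m le_rfl) (hQ hx) (hST hxS)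

theorem IsTightComp.exists_next {G : SimpleGraph V} (hlf : LocFin G) {R : ℕ → V}
    (hR : IsRay G R) {X : Set V} (hX : IsTightComp G R X) :
    ∃ Y, IsTightComp G R Y ∧ Y ⊆ X ∧ NSet G Y ⊆ X := by
  obtain ⟨T, hT, hST, m, hm, hY⟩ :=
    exists_isTightComp hR (hX.finite_NSet.union (finite_ZSet hlf hX.finite_NSet))
  have hsub : compOf G T (R m) ⊆ X := by
    obtain ⟨n, hn⟩ := hX.exists_tail hR
    have h₁ := hR.mem_compOf hm (le_max_left m n)
    have h₂ : compOf G T (R (max m n)) ⊆ X :=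
      compOf_subset (hn _ (le_max_right m n)) (Set.subset_union_left.trans hST)
    exact fun x hx => h₂ (SimpleGraph.Reachable.trans h₁.symm hx)
  refine ⟨_, hY, hsub, ?_⟩
  rintro y ⟨-, x, hx, hxy⟩
  by_contra hyX
  exact notMem_of_mem_compOf (hm m le_rfl) hx (hST (.inr ⟨hsub hx, y, hyX, hxy⟩))

/-- A nested sequence of sets with each boundary inside the preceding set eventually avoids every
finite set of vertices of a connected graph, unless its first member contains all vertices. -/
theorem exists_disjoint_of_nested {G : SimpleGraph V} (hconn : G.Connected) {X : ℕ → Set V}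
    (hX : ∀ n, X (n + 1) ⊆ X n) (hN : ∀ n, NSet G (X (n + 1)) ⊆ X n) {a : V} (ha : a ∉ X 0)
    {S : Set V} (hS : S.Finite) : ∃ n, Disjoint (X n) S := by
  have hanti : Antitone X := antitone_nat_of_succ_le hX
  have hpt : ∀ v, ∃ n, v ∉ X n := by
    intro v
    have h := (SimpleGraph.reachable_iff_reflTransGen a v).1 (hconn.preconnected a v)
    induction h with
    | refl => exact ⟨0, ha⟩
    | @tail b c _ hbc ih =>
      obtain ⟨n, hn⟩ := ih
      exact ⟨n + 1, fun hc => hn (hN n ⟨fun hb => hn (hX n hb), c, hc, hbc.symm⟩)⟩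
  choose N hN' using hpt
  obtain ⟨n, hn⟩ := (hS.image N).bddAbove
  exact ⟨n, Set.disjoint_left.2 fun x hx hxS => hN' x (hanti (hn ⟨x, hxS, rfl⟩) hx)⟩

/-- The boundary of a tight component bounds the end degree from below. -/
theorem IsTightComp.encard_NSet_le_endDegree {G : SimpleGraph V} (hlf : LocFin G)
    (hconn : G.Connected) {R : ℕ → V} (hR : IsRay G R) {X₀ : Set V} (hX₀ : IsTightComp G R X₀)
    {a : V} (ha : a ∉ X₀) : (NSet G X₀).encard ≤ endDegree G R := by
  choose next hnext using fun X : {X // IsTightComp G R X} => X.2.exists_next hlf hR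
  let X' : ℕ → {X // IsTightComp G R X} :=
    fun n => (fun X => ⟨next X, (hnext X).1⟩)^[n] ⟨X₀, hX₀⟩
  have hsucc : ∀ n, (X' (n + 1)).1 = next (X' n) := fun n => by
    simp only [X', Function.iterate_succ_apply']
  have hXsub : ∀ n, (X' (n + 1)).1 ⊆ (X' n).1 := fun n => hsucc n ▸ (hnext (X' n)).2.1
  have hNsub : ∀ n, NSet G (X' (n + 1)).1 ⊆ (X' n).1 := fun n => hsucc n ▸ (hnext (X' n)).2.2
  obtain ⟨r, hr, hdisj⟩ := exists_disjoint_rays G (fun n => (X' n).1)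
    (fun n => (X' n).2.finite_NSet.toFinset) (fun n => by simp) hXsub
    (fun n v hv => hNsub n (by simpa using hv))
    (fun n Q hQ hQX => by
      obtain ⟨m, hm⟩ := (X' (n + 1)).2.exists_tail hR
      rw [← Set.encard_coe_eq_coe_finsetCard, Set.Finite.coe_toFinset]
      exact (X' n).2.2 Q hQX ⟨m, fun i hi => hQ (hm i hi)⟩)
  have hequiv : ∀ f : ℕ → V, (∀ n, ∃ m, ∀ i, m ≤ i → f i ∈ (X' n).1) → RayEquiv G f R := by
    intro f hf S hS
    obtain ⟨n, hn⟩ := exists_disjoint_of_nested hconn (X := fun n => (X' n).1) hXsub hNsub ha hS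
    obtain ⟨p, hp⟩ := hf n
    obtain ⟨q, hq⟩ := (X' n).2.exists_tail hR
    refine ⟨p, q, fun i hi => Set.disjoint_left.1 hn (hp i hi),
      fun i hi => Set.disjoint_left.1 hn (hq i hi), ?_⟩
    obtain ⟨⟨T, -, m, -, hXT⟩, -⟩ := (X' n).2
    rw [hXT] at hn
    have hsub := compOf_subset_compOf_of_disjoint hn
    have h₁ := hsub (hXT ▸ hp p le_rfl)
    have h₂ := hsub (hXT ▸ hq q le_rfl)
    exact SimpleGraph.Reachable.trans (SimpleGraph.Reachable.symm h₁) h₂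
  have hfin := hX₀.finite_NSet
  let e := hfin.toFinset.equivFin.symm
  have hmem : ∀ i, (e i : V) ∈ (X' 0).2.finite_NSet.toFinset := fun i => (e i).2
  rw [← hfin.coe_toFinset, Set.encard_coe_eq_coe_finsetCard]
  refine le_iSup₂_of_le (f := fun (n : ℕ) _ => (n : ℕ∞)) hfin.toFinset.card
    ⟨fun i => r (e i), fun i => ?_, fun i j hij => ?_⟩ le_rfl
  · exact ⟨(hr _ (hmem i)).1, hequiv _ (hr _ (hmem i)).2⟩
  · exact hdisj _ (hmem i) _ (hmem j) fun h => hij (e.injective (Subtype.ext h))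

theorem exists_encard_NSet_le {G : SimpleGraph V} (hlf : LocFin G)
    (hconn : G.Connected) {R : ℕ → V} (hR : IsRay G R) {S : Set V} (hS : S.Finite) :
    ∃ T : Set V, T.Finite ∧ S ⊆ T ∧ ∃ m : ℕ, (∀ i, m ≤ i → R i ∉ T) ∧
      (NSet G (compOf G T (R m))).encard ≤ endDegree G R := by
  obtain ⟨T, hT, hST, m, hm, htight⟩ := exists_isTightComp hR (hS.insert (R 0))
  refine ⟨T, hT, (Set.subset_insert _ _).trans hST, m, hm,
    htight.encard_NSet_le_endDegree hlf hconn hR (a := R 0) fun h => ?_⟩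
  exact notMem_of_mem_compOf (hm m le_rfl) h (hST (Set.mem_insert _ _))

/-- Adding its boundary to a component `C(T, α)` yields a component whose inner boundary is at
most the outer boundary of the original one. -/
theorem exists_encard_ZSet_le {G : SimpleGraph V} (hlf : LocFin G)
    (hconn : G.Connected) {R : ℕ → V} (hR : IsRay G R) {S : Set V} (hS : S.Finite) :
    ∃ T : Set V, T.Finite ∧ S ⊆ T ∧ ∃ m : ℕ, (∀ i, m ≤ i → R i ∉ T) ∧
      (ZSet G (compOf G T (R m))).encard ≤ endDegree G R := by
  obtain ⟨T, hT, hST, m, hm, hk⟩ := exists_encard_NSet_le hlf hconn hR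
    (hS.union (hS.biUnion fun v _ => hlf v))
  set C := compOf G T (R m) with hC
  let C' : Set V := C ∪ NSet G C
  have hCT : ∀ x ∈ C, x ∉ T := fun x hx => notMem_of_mem_compOf (hm m le_rfl) hx
  have hNfin : (NSet G C).Finite := hT.subset (NSet_compOf_subset (hm m le_rfl))
  have hN'fin : (NSet G C').Finite := by
    refine (hNfin.biUnion fun v _ => hlf v).subset ?_
    rintro y ⟨hy, x, hx | hx, hxy⟩
    · exact absurd (.inr ⟨fun h => hy (.inl h), x, hx, hxy⟩) hy
    · exact Set.mem_biUnion hx hxy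
  have hdisj : Disjoint C' S := by
    rw [Set.disjoint_left]
    rintro x (hx | ⟨-, y, hy, hyx⟩) hxS
    · exact hCT x hx (hST (.inl hxS))
    · exact hCT y hy (hST (.inr (Set.mem_biUnion hxS hyx.symm)))
  have htail : ∀ i, m ≤ i → R i ∈ C' := fun i hi => .inl (hR.mem_compOf hm hi)
  obtain ⟨hav, hsub, -⟩ := exists_compOf_subset (G := G) hdisj htail
  have hout : ∀ x ∈ C', x ∉ S ∪ NSet G C' := by
    rintro x hx (h | h)
    exacts [Set.disjoint_left.1 hdisj hx h, h.1 hx]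
  have hCsub : C ⊆ compOf G (S ∪ NSet G C') (R m) :=
    compOf_subset_compOf_of_disjoint (Set.disjoint_left.2 fun x hx => hout x (.inl hx))
  have hC'sub : C' ⊆ compOf G (S ∪ NSet G C') (R m) := by
    rintro y (hy | hy)
    · exact hCsub hy
    · have ⟨_, x, hx, hxy⟩ := hy
      exact mem_compOf_of_adj (hav m le_rfl) (hCsub hx) hxy (hout y (.inr hy))
  refine ⟨S ∪ NSet G C', hS.union hN'fin, Set.subset_union_left, m, hav, ?_⟩
  rw [hsub.antisymm hC'sub]
  refine (Set.encard_le_encard ?_).trans hk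
  rintro x ⟨hx | hx, y, hy, hxy⟩
  · exact absurd (.inr ⟨fun h => hy (.inl h), x, hx, hxy⟩) hy
  · exact hx

/-- For an end `α` of `G` (represented by a ray `R`) and `k ≥ 1`, the
following are equivalent: (1) `d(α) ≤ k`; (2) every finite `S` extends to a finite `T`
with `|Z_G(C(T,α))| ≤ k`; (3) every finite `S` extends to a finite `T` with
`|N_G(C(T,α))| ≤ k`. -/
theorem endDegree_le_iff {V : Type u} (G : SimpleGraph V)
    (hinf : Infinite V) (hlf : LocFin G) (hconn : G.Connected)
    (R : ℕ → V) (hR : IsRay G R) (k : ℕ) (hk : 1 ≤ k) :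
    (endDegree G R ≤ (k : ℕ∞) ↔
      ∀ S : Set V, S.Finite → ∃ T : Set V, T.Finite ∧ S ⊆ T ∧
        ∃ m : ℕ, (∀ i, m ≤ i → R i ∉ T) ∧
          (ZSet G (compOf G T (R m))).encard ≤ (k : ℕ∞)) ∧
    (endDegree G R ≤ (k : ℕ∞) ↔
      ∀ S : Set V, S.Finite → ∃ T : Set V, T.Finite ∧ S ⊆ T ∧
        ∃ m : ℕ, (∀ i, m ≤ i → R i ∉ T) ∧
          (NSet G (compOf G T (R m))).encard ≤ (k : ℕ∞)) := by
  refine ⟨⟨fun h S hS => ?_, fun h => ?_⟩, ⟨fun h S hS => ?_, fun h => ?_⟩⟩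
  · obtain ⟨T, hT, hST, m, hm, hle⟩ := exists_encard_ZSet_le hlf hconn hR hS
    exact ⟨T, hT, hST, m, hm, hle.trans h⟩
  · exact endDegree_le_of_boundary hR (ZSet G)
      (fun X x y hx hy hxy => .inr ⟨hy, x, hx, hxy.symm⟩) h
  · obtain ⟨T, hT, hST, m, hm, hle⟩ := exists_encard_NSet_le hlf hconn hR hS
    exact ⟨T, hT, hST, m, hm, hle.trans h⟩
  · exact endDegree_le_of_boundary hR (NSet G)
      (fun X x y hx hy hxy => .inl ⟨hx, y, hy, hxy.symm⟩) h

end IGraph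
end

section
/- Let G be a subcubic graph, S a finite subset of V(G), and D a finite 2-connected bipartite subgraph of G. If S ∩ V(D) ≠ ∅ and S is 3-connected in G, then G has a finite 2-connected bipartite subgraph F with D ≤ F (D a subgraph of F) and S ⊆ V(F). -/
namespace IGraph

open SimpleGraph

universe u w

variable {V : Type u} {W : Type w}

/-- No vertex `z` separates two other vertices of `F`. -/
def NoSeparatingVertex {G : SimpleGraph V} (F : G.Subgraph) : Prop :=
  ∀ z, ∀ a ∈ F.verts, ∀ b ∈ F.verts, a ≠ z → b ≠ z → (del F.spanningCoe {z}).Reachable a b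

/-- `c` is a proper 2-colouring of the vertices of `F`, as a function on all of `V`. -/
def ProperOn {G : SimpleGraph V} (F : G.Subgraph) (c : V → Bool) : Prop :=
  ∀ u v, F.Adj u v → c u ≠ c v

lemma exists_properOn_of_colorable {G : SimpleGraph V} {F : G.Subgraph}
    (h : F.coe.Colorable 2) : ∃ c, ProperOn F c := by
  classical
  obtain ⟨C⟩ := h
  refine ⟨fun v => if hv : v ∈ F.verts then decide (C ⟨v, hv⟩ = 0) else false, ?_⟩
  intro u v huv
  have hu := F.edge_vert huv
  have hv := F.edge_vert huv.symm
  have hne : C ⟨u, hu⟩ ≠ C ⟨v, hv⟩ := C.valid (by simpa using huv)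
  simp only [hu, hv, dif_pos, ne_eq, decide_eq_decide]
  omega

lemma ProperOn.colorable {G : SimpleGraph V} {F : G.Subgraph} {c : V → Bool}
    (h : ProperOn F c) : F.coe.Colorable 2 := by
  have C : F.coe.Coloring Bool :=
    Coloring.mk (fun v => c v) (fun {u v} huv => h u v (by simpa using huv))
  simpa using C.colorable

lemma IsKConn.noSeparatingVertex {G : SimpleGraph V} {F : G.Subgraph}
    (h : IsKConn 2 F.coe) : NoSeparatingVertex F := by
  intro z a ha b hb haz hbz
  have hsub : {w : F.verts | w.1 = z}.Subsingleton := fun x hx y hy =>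
    Subtype.ext (hx.trans hy.symm)
  have hcard : {w : F.verts | w.1 = z}.ncard < 2 := by
    have := (Set.ncard_le_one hsub.finite).2 hsub
    omega
  have hconn := h.2 _ hsub.finite hcard
  let φ : F.coe.induce {w : F.verts | w.1 = z}ᶜ →g del F.spanningCoe {z} :=
    { toFun := fun w => w.1.1
      map_rel' := fun {x y} hxy => ⟨by simpa using hxy, x.2, y.2⟩ }
  exact (hconn.preconnected ⟨⟨a, ha⟩, haz⟩ ⟨⟨b, hb⟩, hbz⟩).map φ

lemma IsKConn.exists_ne_ne {H : SimpleGraph W} (h : IsKConn 2 H) (y z : W) :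
    ∃ x, x ≠ y ∧ x ≠ z := by
  apply Cardinal.exists_ne_ne_of_three_le
  have := Order.succ_le_of_lt h.1
  rw [Cardinal.succ_natCast] at this
  exact_mod_cast this

lemma reachable_induce_of_walk_del {G : SimpleGraph V} {F : G.Subgraph} {z : V}
    {X : Set F.verts} (hX : ∀ x ∈ X, x.1 = z) {a b : V} (w : (del F.spanningCoe {z}).Walk a b) :
    ∀ (ha : a ∈ F.verts) (hb : b ∈ F.verts) (haX : ⟨a, ha⟩ ∈ Xᶜ) (hbX : ⟨b, hb⟩ ∈ Xᶜ),
      (F.coe.induce Xᶜ).Reachable ⟨⟨a, ha⟩, haX⟩ ⟨⟨b, hb⟩, hbX⟩ := by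
  induction w with
  | nil => intros; rfl
  | @cons a v b h w ih =>
    intro ha hb haX hbX
    have hv : v ∈ F.verts := F.edge_vert (Subgraph.Adj.symm h.1)
    have hvX : (⟨v, hv⟩ : F.verts) ∈ Xᶜ := fun hx => h.2.2 (hX _ hx)
    refine Reachable.trans (Adj.reachable ?_) (ih hv hb hvX hbX)
    simpa using h.1

lemma NoSeparatingVertex.isKConn {G : SimpleGraph V} {F : G.Subgraph}
    (h : NoSeparatingVertex F) (hcard : 2 < Cardinal.mk F.verts) : IsKConn 2 F.coe := by
  have hthree : (3 : Cardinal) ≤ Cardinal.mk F.verts := by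
    have := Order.succ_le_of_lt (show ((2 : ℕ) : Cardinal) < _ from mod_cast hcard)
    rw [Cardinal.succ_natCast] at this
    exact_mod_cast this
  refine ⟨mod_cast hcard, fun X hXfin hX => ?_⟩
  have hXsub : X.Subsingleton := (Set.ncard_le_one hXfin).1 (by omega)
  obtain ⟨x₀⟩ : Nonempty F.verts := by
    rw [← Cardinal.mk_ne_zero_iff]
    exact (bot_lt_of_lt hcard).ne'
  have hne : Nonempty ↑Xᶜ := by
    rcases X.eq_empty_or_nonempty with rfl | ⟨x, hx⟩
    · exact ⟨x₀, by simp⟩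
    · obtain ⟨y, hy, -⟩ := Cardinal.exists_ne_ne_of_three_le hthree x x
      exact ⟨y, fun hyX => hy (hXsub hyX hx)⟩
  refine { preconnected := ?_, nonempty := hne }
  rintro ⟨⟨a, ha⟩, haX⟩ ⟨⟨b, hb⟩, hbX⟩
  obtain ⟨z, hz, haz, hbz⟩ : ∃ z : V, (∀ x ∈ X, x.1 = z) ∧ a ≠ z ∧ b ≠ z := by
    rcases X.eq_empty_or_nonempty with rfl | ⟨x, hx⟩
    · obtain ⟨y, hya, hyb⟩ := Cardinal.exists_ne_ne_of_three_le hthree ⟨a, ha⟩ ⟨b, hb⟩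
      exact ⟨y, by simp, fun e => hya (Subtype.ext e.symm), fun e => hyb (Subtype.ext e.symm)⟩
    · refine ⟨x, fun y hy => congrArg _ (hXsub hy hx), ?_, ?_⟩
      · rintro rfl; exact haX hx
      · rintro rfl; exact hbX hx
  obtain ⟨w⟩ := h z a ha b hb haz hbz
  exact reachable_induce_of_walk_del hz w ha hb haX hbX

lemma IsKConn.exists_adj_ne {G : SimpleGraph V} {F : G.Subgraph} (h : IsKConn 2 F.coe)
    {s : V} (hs : s ∈ F.verts) {z : V} (hz : z ∈ F.verts) (hsz : s ≠ z) :
    ∃ n, F.Adj s n ∧ n ≠ z := by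
  obtain ⟨⟨b, hb⟩, hbs, hbz⟩ := h.exists_ne_ne ⟨s, hs⟩ ⟨z, hz⟩
  have hbs' : b ≠ s := fun e => hbs (Subtype.ext e)
  have hbz' : b ≠ z := fun e => hbz (Subtype.ext e)
  obtain ⟨w⟩ := h.noSeparatingVertex z s hs b hb hsz hbz'
  cases w with
  | nil => exact absurd rfl hbs'
  | cons hadj _ => exact ⟨_, hadj.1, hadj.2.2⟩

lemma IsKConn.exists_two_adj {G : SimpleGraph V} {F : G.Subgraph} (h : IsKConn 2 F.coe)
    {s : V} (hs : s ∈ F.verts) : ∃ m n, F.Adj s m ∧ F.Adj s n ∧ m ≠ n := by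
  obtain ⟨⟨z, hz⟩, hzs, -⟩ := h.exists_ne_ne ⟨s, hs⟩ ⟨s, hs⟩
  obtain ⟨m, hm, -⟩ := h.exists_adj_ne hs hz (fun e => hzs (Subtype.ext e.symm))
  obtain ⟨n, hn, hnm⟩ := h.exists_adj_ne hs (F.edge_vert hm.symm) hm.ne
  exact ⟨m, n, hm, hn, hnm.symm⟩

/-- The initial segment of a path up to its first vertex in `A`. -/
lemma exists_first_hit {G : SimpleGraph V} (A : Set V) {t s : V} (p : G.Walk t s)
    (hp : p.IsPath) (hs : s ∈ A) :
    ∃ x ∈ A, ∃ q : G.Walk t x, q.IsPath ∧ (∀ y ∈ q.support, y ∈ p.support) ∧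
      (∀ y ∈ q.support, y ∈ A → y = x) ∧
      (x = s → ∀ y ∈ p.support, y ≠ s → y ∉ A) := by
  induction p with
  | nil => exact ⟨_, hs, .nil, by simp, by simp, by simp, by simp⟩
  | @cons t v s h p ih =>
    rw [Walk.cons_isPath_iff] at hp
    by_cases ht : t ∈ A
    · refine ⟨t, ht, .nil, by simp, by simp, by simp, ?_⟩
      rintro rfl
      exact absurd p.end_mem_support hp.2
    · obtain ⟨x, hx, q, hq, hqp, hqA, hend⟩ := ih hp.1 hs
      refine ⟨x, hx, .cons h q, ?_, ?_, ?_, ?_⟩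
      · rw [Walk.cons_isPath_iff]
        exact ⟨hq, fun e => hp.2 (hqp _ e)⟩
      · intro y hy
        rw [Walk.support_cons, List.mem_cons] at hy ⊢
        exact hy.imp_right (hqp y)
      · intro y hy hyA
        rw [Walk.support_cons, List.mem_cons] at hy
        rcases hy with rfl | hy
        · exact absurd hyA ht
        · exact hqA y hy hyA
      · intro hxs y hy hys
        rw [Walk.support_cons, List.mem_cons] at hy
        rcases hy with rfl | hy
        · exact ht
        · exact hend hxs y hy hys

/-- A path can be properly 2-coloured with a prescribed colour at its end. -/
lemma exists_properOn_path {G : SimpleGraph V} {t x : V} (p : G.Walk t x) (hp : p.IsPath)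
    (b : Bool) : ∃ f, f x = b ∧ ProperOn p.toSubgraph f := by
  classical
  induction p with
  | nil => exact ⟨fun _ => b, rfl, fun u v h => by simp at h⟩
  | @cons t v x h p ih =>
    rw [Walk.cons_isPath_iff] at hp
    obtain ⟨f, hfx, hf⟩ := ih hp.1
    have hne : ∀ y ∈ p.support, Function.update f t (!f v) y = f y := fun y hy =>
      Function.update_of_ne (by rintro rfl; exact hp.2 hy) _ _
    refine ⟨Function.update f t (!f v), (hne x p.end_mem_support).trans hfx, ?_⟩
    intro y z hyz
    rw [Walk.toSubgraph, Subgraph.sup_adj, subgraphOfAdj_adj] at hyz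
    rcases hyz with hyz | hyz
    · have hv := hne v p.start_mem_support
      rw [Sym2.eq_iff] at hyz
      rcases hyz with ⟨rfl, rfl⟩ | ⟨rfl, rfl⟩ <;> simp [hv]
    · rw [hne y (p.mem_verts_toSubgraph.1 (p.toSubgraph.edge_vert hyz)),
        hne z (p.mem_verts_toSubgraph.1 (p.toSubgraph.edge_vert hyz.symm))]
      exact hf y z hyz

lemma reachable_del_of_walk {G : SimpleGraph V} {F : G.Subgraph} {z a b : V} (p : G.Walk a b)
    (hpF : p.toSubgraph ≤ F) (hz : z ∉ p.support) : (del F.spanningCoe {z}).Reachable a b := by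
  induction p with
  | nil => rfl
  | @cons a v b h p ih =>
    rw [Walk.toSubgraph, sup_le_iff] at hpF
    rw [Walk.support_cons, List.mem_cons, not_or] at hz
    refine Reachable.trans (Adj.reachable ⟨?_, Ne.symm hz.1, ?_⟩) (ih hpF.2 hz.2)
    · exact hpF.1.2 (by simp)
    · rintro rfl
      exact hz.2 p.start_mem_support

/-- Two paths which meet only in their common start `t`, seen inside `F`: every vertex `w ≠ z` of
the first path reaches the end of one of them while avoiding `z`. -/
lemma reachable_end_or_end {G : SimpleGraph V} {F : G.Subgraph} {t x y : V}
    {p : G.Walk t x} {q : G.Walk t y} (hp : p.IsPath) (hpF : p.toSubgraph ≤ F)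
    (hqF : q.toSubgraph ≤ F) (hpq : ∀ v ∈ p.support, v ∈ q.support → v = t) {w z : V}
    (hw : w ∈ p.support) (hwz : w ≠ z) :
    (x ≠ z ∧ (del F.spanningCoe {z}).Reachable w x) ∨
      (y ≠ z ∧ (del F.spanningCoe {z}).Reachable w y) := by
  classical
  have hsub : (p.takeUntil w hw).toSubgraph ≤ F ∧ (p.dropUntil w hw).toSubgraph ≤ F := by
    rw [← sup_le_iff, ← Walk.toSubgraph_append, Walk.take_spec]
    exact hpF
  by_cases hz : z ∈ (p.dropUntil w hw).support
  · have hzp : z ∈ p.support := p.support_dropUntil_subset_support hw hz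
    have htake : z ∉ (p.takeUntil w hw).support := by
      intro hz'
      have hnodup := hp.support_nodup
      rw [← p.take_spec hw, Walk.support_append, List.nodup_append] at hnodup
      rw [Walk.mem_support_iff] at hz
      exact hnodup.2.2 z hz' z (hz.resolve_left hwz.symm) rfl
    have htz : t ≠ z := by
      rintro rfl
      exact htake (Walk.start_mem_support _)
    have hzq : z ∉ q.support := fun h => htz (hpq z hzp h).symm
    refine .inr ⟨fun e => hzq (e ▸ q.end_mem_support), ?_⟩
    exact (reachable_del_of_walk _ hsub.1 htake).symm.trans (reachable_del_of_walk _ hqF hzq)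
  · exact .inl ⟨fun e => hz (e ▸ Walk.end_mem_support _), reachable_del_of_walk _ hsub.2 hz⟩

/-- Attaching to `D` two paths from `t` to `D` that meet only in `t` creates no separating
vertex. -/
lemma NoSeparatingVertex.sup_paths {G : SimpleGraph V} {D : G.Subgraph}
    (h : NoSeparatingVertex D) {t x y : V} {p : G.Walk t x} {q : G.Walk t y} (hp : p.IsPath)
    (hq : q.IsPath) (hx : x ∈ D.verts) (hy : y ∈ D.verts)
    (hpq : ∀ v ∈ p.support, v ∈ q.support → v = t) :
    NoSeparatingVertex (D ⊔ (p.toSubgraph ⊔ q.toSubgraph)) := by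
  set F := D ⊔ (p.toSubgraph ⊔ q.toSubgraph) with hF
  have hDF : D ≤ F := le_sup_left
  have hpF : p.toSubgraph ≤ F := le_sup_left.trans le_sup_right
  have hqF : q.toSubgraph ≤ F := le_sup_right.trans le_sup_right
  have key : ∀ z, ∀ a ∈ F.verts, a ≠ z →
      ∃ d ∈ D.verts, d ≠ z ∧ (del F.spanningCoe {z}).Reachable a d := by
    intro z a ha haz
    rw [hF, Subgraph.verts_sup, Subgraph.verts_sup] at ha
    rcases ha with ha | ha | ha
    · exact ⟨a, ha, haz, .refl _⟩
    · rcases reachable_end_or_end hp hpF hqF hpq (p.mem_verts_toSubgraph.1 ha) haz with h | h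
      exacts [⟨x, hx, h⟩, ⟨y, hy, h⟩]
    · rcases reachable_end_or_end hq hqF hpF (fun v hv hv' => hpq v hv' hv)
        (q.mem_verts_toSubgraph.1 ha) haz with h | h
      exacts [⟨y, hy, h⟩, ⟨x, hx, h⟩]
  intro z a ha b hb haz hbz
  obtain ⟨d, hd, hdz, had⟩ := key z a ha haz
  obtain ⟨e, he, hez, hbe⟩ := key z b hb hbz
  have hde : (del F.spanningCoe {z}).Reachable d e :=
    (h z d hd e he hdz hez).mono (by intro u v huv; exact ⟨hDF.2 huv.1, huv.2⟩)
  exact had.trans (hde.trans hbe.symm)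

lemma exists_properOn_sup_paths {G : SimpleGraph V} {D : G.Subgraph} {c f g : V → Bool}
    {t x y : V} {p : G.Walk t x} {q : G.Walk t y} (hc : ProperOn D c)
    (hf : ProperOn p.toSubgraph f) (hg : ProperOn q.toSubgraph g) (hfx : f x = c x)
    (hgy : g y = c y) (hfg : f t = g t) (hpD : ∀ v ∈ p.support, v ∈ D.verts → v = x)
    (hqD : ∀ v ∈ q.support, v ∈ D.verts → v = y)
    (hpq : ∀ v ∈ p.support, v ∈ q.support → v = t) :
    ∃ c', ProperOn (D ⊔ (p.toSubgraph ⊔ q.toSubgraph)) c' := by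
  classical
  let c' : V → Bool := fun v => if v ∈ D.verts then c v else if v ∈ p.support then f v else g v
  have hcD : ∀ v ∈ D.verts, c' v = c v := fun v hv => by simp [c', hv]
  have hcp : ∀ v ∈ p.support, c' v = f v := by
    intro v hv
    by_cases hvD : v ∈ D.verts
    · obtain rfl := hpD v hv hvD
      rw [hcD _ hvD, hfx]
    · simp [c', hvD, hv]
  have hcq : ∀ v ∈ q.support, c' v = g v := by
    intro v hv
    by_cases hvp : v ∈ p.support
    · obtain rfl := hpq v hvp hv
      rw [hcp _ hvp, hfg]
    by_cases hvD : v ∈ D.verts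
    · obtain rfl := hqD v hv hvD
      rw [hcD _ hvD, hgy]
    · simp [c', hvD, hvp]
  refine ⟨c', fun u v huv => ?_⟩
  rw [Subgraph.sup_adj, Subgraph.sup_adj] at huv
  rcases huv with h | h | h
  · rw [hcD u (D.edge_vert h), hcD v (D.edge_vert h.symm)]
    exact hc u v h
  · rw [hcp u (p.mem_verts_toSubgraph.1 (p.toSubgraph.edge_vert h)),
      hcp v (p.mem_verts_toSubgraph.1 (p.toSubgraph.edge_vert h.symm))]
    exact hf u v h
  · rw [hcq u (q.mem_verts_toSubgraph.1 (q.toSubgraph.edge_vert h)),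
      hcq v (q.mem_verts_toSubgraph.1 (q.toSubgraph.edge_vert h.symm))]
    exact hg u v h

/-- In a subcubic graph, two distinct internally disjoint paths ending in a vertex `s` of a
2-connected subgraph `D` cannot both meet `D` only in `s`. -/
lemma not_both_meet_only_at_end {G : SimpleGraph V} (hsc : Subcubic G)
    {D : G.Subgraph} (hD : IsKConn 2 D.coe) {t s : V} (hts : t ≠ s) (hs : s ∈ D.verts)
    {p q : G.Walk t s} (hp : p.IsPath) (hq : q.IsPath) (hne : p ≠ q)
    (hpq : ∀ v ∈ p.support, v ∈ q.support → v = t ∨ v = s)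
    (hpD : ∀ v ∈ p.support, v ≠ s → v ∉ D.verts) (hqD : ∀ v ∈ q.support, v ≠ s → v ∉ D.verts) :
    False := by
  classical
  have hpn : ¬ p.Nil := fun h => hts h.eq
  have hqn : ¬ q.Nil := fun h => hts h.eq
  have hpa := p.adj_penultimate hpn
  have hqa := q.adj_penultimate hqn
  have hpm : p.penultimate ∈ p.support := p.getVert_mem_support _
  have hqm : q.penultimate ∈ q.support := q.getVert_mem_support _
  have hpen : p.penultimate ≠ q.penultimate := by
    intro e
    have single : ∀ r : G.Walk t s, r.IsPath → r.penultimate = t → ∃ h : G.Adj t s,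
        r = .cons h .nil := by
      intro r hr hrt
      cases r with
      | nil => exact absurd rfl hts
      | cons h r =>
        cases r with
        | nil => exact ⟨h, rfl⟩
        | cons h' r =>
          rw [Walk.penultimate_cons_of_not_nil _ _ Walk.not_nil_cons] at hrt
          refine absurd ?_ ((Walk.cons_isPath_iff _ _).1 hr).2
          rw [← hrt]
          exact Walk.getVert_mem_support _ _
    have hpt : p.penultimate = t :=
      (hpq _ hpm (e ▸ hqm)).resolve_right hpa.ne
    obtain ⟨_, h₁⟩ := single p hp hpt
    obtain ⟨_, h₂⟩ := single q hq (e ▸ hpt)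
    exact hne (h₁.trans h₂.symm)
  obtain ⟨m, n, hm, hn, hmn⟩ := hD.exists_two_adj hs
  have hmD := D.edge_vert hm.symm
  have hnD := D.edge_vert hn.symm
  have hpnot := hpD _ hpm hpa.ne
  have hqnot := hqD _ hqm hqa.ne
  have hsub : (({p.penultimate, q.penultimate, m, n} : Finset V) : Set V) ⊆ G.neighborSet s := by
    intro v hv
    simp only [Finset.coe_insert, Finset.coe_singleton, Set.mem_insert_iff,
      Set.mem_singleton_iff] at hv
    rcases hv with rfl | rfl | rfl | rfl
    exacts [hpa.symm, hqa.symm, hm.adj_sub, hn.adj_sub]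
  have hle := (Set.ncard_le_ncard hsub (hsc s).1).trans (hsc s).2
  rw [Set.ncard_coe_finset, Finset.card_insert_of_notMem, Finset.card_insert_of_notMem,
    Finset.card_pair hmn] at hle
  · omega
  · simp only [Finset.mem_insert, Finset.mem_singleton, not_or]
    exact ⟨fun e => hqnot (e ▸ hmD), fun e => hqnot (e ▸ hnD)⟩
  · simp only [Finset.mem_insert, Finset.mem_singleton, not_or]
    exact ⟨hpen, fun e => hpnot (e ▸ hmD), fun e => hpnot (e ▸ hnD)⟩

/-- A finite 2-connected bipartite subgraph meeting a 3-connected set `S` can be enlarged to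
contain any prescribed further vertex of `S`. -/
lemma exists_bipartite_extension_mem {G : SimpleGraph V} (hsc : Subcubic G) {S : Set V}
    (hS3 : ThreeConnIn G S) {D : G.Subgraph} (hDfin : D.verts.Finite) (hD2 : IsKConn 2 D.coe)
    (hDbip : D.coe.Colorable 2) {s t : V} (hsS : s ∈ S) (hsD : s ∈ D.verts) (htS : t ∈ S)
    (htD : t ∉ D.verts) :
    ∃ F : G.Subgraph, F.verts.Finite ∧ D ≤ F ∧ t ∈ F.verts ∧ IsKConn 2 F.coe ∧
      F.coe.Colorable 2 := by
  have hts : t ≠ s := by rintro rfl; exact htD hsD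
  obtain ⟨c, hc⟩ := exists_properOn_of_colorable hDbip
  obtain ⟨p₁, p₂, p₃, h₁₂, h₁₃, h₂₃, d₁₂, d₁₃, d₂₃⟩ := hS3 t s htS hsS hts
  have fan : ∀ p : G.Path t s, ∃ x ∈ D.verts, ∃ q : G.Walk t x, q.IsPath ∧
      (∀ y ∈ q.support, y ∈ p.1.support) ∧ (∀ y ∈ q.support, y ∈ D.verts → y = x) ∧
      (x = s → ∀ y ∈ p.1.support, y ≠ s → y ∉ D.verts) ∧
      ∃ f, f x = c x ∧ ProperOn q.toSubgraph f := by
    intro p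
    obtain ⟨x, hx, q, hq, hqp, hqD, hend⟩ := exists_first_hit D.verts p.1 p.2 hsD
    exact ⟨x, hx, q, hq, hqp, hqD, hend, exists_properOn_path q hq (c x)⟩
  choose x hx q hq hqp hqD hend f hfx hf using fan
  have extend : ∀ p p' : G.Path t s, p ≠ p' →
      (∀ v, v ∈ p.1.support → v ∈ p'.1.support → v = t ∨ v = s) → f p t = f p' t →
      ∃ F : G.Subgraph, F.verts.Finite ∧ D ≤ F ∧ t ∈ F.verts ∧ IsKConn 2 F.coe ∧
        F.coe.Colorable 2 := by
    intro p p' hne hdisj hft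
    have hpq : ∀ v ∈ (q p).support, v ∈ (q p').support → v = t := by
      intro v hv hv'
      refine (hdisj v (hqp p v hv) (hqp p' v hv')).resolve_right ?_
      rintro rfl
      exact not_both_meet_only_at_end hsc hD2 hts hsD p.2 p'.2
        (fun e => hne (Subtype.ext e)) hdisj (hend p (hqD p _ hv hsD).symm)
        (hend p' (hqD p' _ hv' hsD).symm)
    obtain ⟨c', hc'⟩ := exists_properOn_sup_paths hc (hf p) (hf p') (hfx p) (hfx p') hft
      (hqD p) (hqD p') hpq
    refine ⟨D ⊔ ((q p).toSubgraph ⊔ (q p').toSubgraph), ?_, le_sup_left, ?_, ?_, hc'.colorable⟩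
    · rw [Subgraph.verts_sup, Subgraph.verts_sup, Walk.verts_toSubgraph, Walk.verts_toSubgraph]
      exact hDfin.union ((List.finite_toSet _).union (List.finite_toSet _))
    · exact .inr (.inl ((q p).mem_verts_toSubgraph.2 (Walk.start_mem_support _)))
    · refine (hD2.noSeparatingVertex.sup_paths (hq p) (hq p') (hx p) (hx p') hpq).isKConn ?_
      exact lt_of_lt_of_le (mod_cast hD2.1) (Cardinal.mk_le_mk_of_subset Set.subset_union_left)
  by_cases e₁₂ : f p₁ t = f p₂ t
  · exact extend p₁ p₂ h₁₂ d₁₂ e₁₂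
  by_cases e₁₃ : f p₁ t = f p₃ t
  · exact extend p₁ p₃ h₁₃ d₁₃ e₁₃
  · exact extend p₂ p₃ h₂₃ d₂₃ (by
      revert e₁₂ e₁₃
      cases f p₁ t <;> cases f p₂ t <;> cases f p₃ t <;> simp)

/-- In a subcubic graph `G`, if `S` is a finite set that is 3-connected in
`G`, `D` is a finite 2-connected bipartite subgraph of `G` and `S ∩ V(D) ≠ ∅`, then `G`
has a finite 2-connected bipartite subgraph `F` with `D ≤ F` and `S ⊆ V(F)`. -/
theorem exists_bipartite_extension {V : Type u} (G : SimpleGraph V) (hsc : Subcubic G)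
    (S : Set V) (hSfin : S.Finite)
    (D : G.Subgraph) (hDfin : D.verts.Finite) (hD2 : IsKConn 2 D.coe)
    (hDbip : D.coe.Colorable 2)
    (hSD : (S ∩ D.verts).Nonempty) (hS3 : ThreeConnIn G S) :
    ∃ F : G.Subgraph, F.verts.Finite ∧ D ≤ F ∧ S ⊆ F.verts ∧
      IsKConn 2 F.coe ∧ F.coe.Colorable 2 := by
  induction hn : (S \ D.verts).ncard using Nat.strong_induction_on generalizing D with
  | _ n ih =>
    by_cases hS : S ⊆ D.verts
    · exact ⟨D, hDfin, le_rfl, hS, hD2, hDbip⟩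
    obtain ⟨t, htS, htD⟩ := Set.not_subset.1 hS
    obtain ⟨s, hsS, hsD⟩ := hSD
    obtain ⟨E, hEfin, hDE, htE, hE2, hEbip⟩ :=
      exists_bipartite_extension_mem hsc hS3 hDfin hD2 hDbip hsS hsD htS htD
    have hlt : (S \ E.verts).ncard < n := by
      rw [← hn]
      refine Set.ncard_lt_ncard ⟨Set.sdiff_subset_sdiff_right hDE.1, fun h => ?_⟩ hSfin.sdiff
      exact (h ⟨htS, htD⟩).2 htE
    obtain ⟨F, hFfin, hEF, hSF, hF2, hFbip⟩ :=
      ih _ hlt E hEfin hE2 hEbip ⟨s, hsS, hDE.1 hsD⟩ rfl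
    exact ⟨F, hFfin, hDE.trans hEF, hSF, hF2, hFbip⟩

end IGraph
end

section
/- Let G be a subcubic graph and let 𝒰 be a finite collection of finite subsets of V(G), each of which is 3-connected in G. Then G has a finite subgraph F such that (1) every set U ∈ 𝒰 is contained in the vertex set of a single component of F, and (2) every component of F is either an isolated vertex or a 2-connected bipartite graph. -/
namespace IGraph

open SimpleGraph

universe u w

variable {V : Type u} {W : Type w}

/-- The bipartite spanning subgraph of `H` formed by the edges that are bichromatic
under `c`. -/
def cutGraph (H : SimpleGraph V) (c : V → Bool) : SimpleGraph V where
  Adj x y := H.Adj x y ∧ c x ≠ c y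
  symm := ⟨fun _ _ h => ⟨h.1.symm, h.2.symm⟩⟩
  loopless := ⟨fun _ h => h.2 rfl⟩

/-- The graph obtained from `B` by deleting all of its bridges. -/
def bridgeless (B : SimpleGraph V) : SimpleGraph V where
  Adj x y := B.Adj x y ∧ ¬ B.IsBridge s(x, y)
  symm := ⟨fun x y h => ⟨h.1.symm, by rw [Sym2.eq_swap]; exact h.2⟩⟩
  loopless := ⟨fun _ h => h.1.ne rfl⟩

theorem exists_maximum_cutGraph (H : SimpleGraph V) (hH : H.edgeSet.Finite) :
    ∃ c : V → Bool, ∀ c' : V → Bool,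
      (cutGraph H c').edgeSet.ncard ≤ (cutGraph H c).edgeSet.ncard := by
  have hb : BddAbove (Set.range fun c : V → Bool => (cutGraph H c).edgeSet.ncard) := by
    refine ⟨H.edgeSet.ncard, ?_⟩
    rintro _ ⟨c, rfl⟩
    exact Set.ncard_le_ncard (edgeSet_mono fun _ _ h => h.1) hH
  obtain ⟨c, hc⟩ := Nat.sSup_mem (Set.range_nonempty _) hb
  exact ⟨c, fun c' => (le_csSup hb ⟨c', rfl⟩).trans hc.ge⟩

/-- If at most one edge of a maximum bipartite subgraph of `H` crosses a cut, then at most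
two edges of `H` cross it: otherwise switching the colours on one side gains an edge. -/
theorem ncard_le_two_of_maximum_cutGraph (H : SimpleGraph V) (hH : H.edgeSet.Finite)
    (c : V → Bool)
    (hc : ∀ c' : V → Bool, (cutGraph H c').edgeSet.ncard ≤ (cutGraph H c).edgeSet.ncard)
    (Y : Set V) (e : Sym2 V)
    (hY : ∀ x y, (cutGraph H c).Adj x y → x ∈ Y → y ∉ Y → s(x, y) = e)
    (D : Set (Sym2 V))
    (hD : ∀ d ∈ D, ∃ x y, H.Adj x y ∧ x ∈ Y ∧ y ∉ Y ∧ d = s(x, y)) : D.ncard ≤ 2 := by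
  classical
  by_contra! hcard
  have hDH : D ⊆ H.edgeSet := by
    intro d hd
    obtain ⟨x, y, h, -, -, rfl⟩ := hD d hd
    exact h
  have hDfin : D.Finite := hH.subset hDH
  let c' : V → Bool := fun x => if x ∈ Y then !c x else c x
  have hfin : ∀ c, (cutGraph H c).edgeSet.Finite := fun c =>
    hH.subset (edgeSet_mono fun _ _ h => h.1)
  have hsub : ((cutGraph H c).edgeSet \ {e}) ∪ (D \ {e}) ⊆ (cutGraph H c').edgeSet := by
    rintro d (⟨hd, hde⟩ | ⟨hd, hde⟩)
    · induction d with | h x y =>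
      have hxy : (cutGraph H c).Adj x y := hd
      refine ⟨hxy.1, ?_⟩
      have h1 := hxy.2
      by_cases hx : x ∈ Y <;> by_cases hy : y ∈ Y
      · simpa [c', hx, hy] using h1
      · exact (hde (hY x y hxy hx hy)).elim
      · exact (hde (Sym2.eq_swap.trans (hY y x hxy.symm hy hx))).elim
      · simpa [c', hx, hy] using h1
    · obtain ⟨x, y, h, hx, hy, rfl⟩ := hD d hd
      refine ⟨h, ?_⟩
      by_contra hne
      refine hde (hY x y ⟨h, ?_⟩ hx hy)
      intro hcc
      simp [c', hx, hy, hcc] at hne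
  have hdisj : Disjoint ((cutGraph H c).edgeSet \ {e}) (D \ {e}) := by
    rw [Set.disjoint_left]
    rintro d ⟨hd, hde⟩ ⟨hd', -⟩
    obtain ⟨x, y, h, hx, hy, rfl⟩ := hD d hd'
    exact hde (hY x y hd hx hy)
  have h1 := Set.ncard_le_ncard hsub (hfin c')
  rw [Set.ncard_union_eq hdisj ((hfin c).subset Set.sdiff_subset)
    (hDfin.subset Set.sdiff_subset)] at h1
  have h2 := hc c'
  have h3 := Set.pred_ncard_le_ncard_sdiff_singleton (cutGraph H c).edgeSet e
  have h4 := Set.pred_ncard_le_ncard_sdiff_singleton D e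
  omega

/-- Vertices that no single edge separates in `B` lie in the same component of
`bridgeless B`. -/
theorem bridgeless_reachable (B : SimpleGraph V) {u v : V}
    (h : ∀ e, (B.deleteEdges {e}).Reachable u v) : (bridgeless B).Reachable u v := by
  classical
  have key : ∀ {u v : V} (p : B.Walk u v), p.IsPath →
      (∀ e, (B.deleteEdges {e}).Reachable u v) → (bridgeless B).Reachable u v := by
    intro u v p
    induction p with
    | nil => intro _ _; rfl
    | @cons u w v huw q ih =>
      intro hp h
      rw [Walk.cons_isPath_iff] at hp
      have hT : ∀ e, (B.deleteEdges {e}).Reachable u w := by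
        intro e
        by_cases he : s(u, w) = e
        · subst he
          refine (h _).trans (Reachable.symm ?_)
          refine reachable_deleteEdges_iff_exists_walk.mpr ⟨q, fun hq => ?_⟩
          exact hp.2 (q.fst_mem_support_of_mem_edges hq)
        · exact Adj.reachable (by simpa [deleteEdges_adj] using ⟨huw, he⟩)
      have hF : (bridgeless B).Adj u w := ⟨huw, fun hb => hb (hT _)⟩
      exact hF.reachable.trans (ih hp.1 fun e => (hT e).symm.trans (h e))
  obtain ⟨p⟩ := (h s(u, u)).mono (deleteEdges_le _)
  exact key p.toPath.1 p.toPath.2 h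

theorem bridgeless_exists_other_neighbor (B : SimpleGraph V) {w x : V}
    (h : (bridgeless B).Adj w x) :
    ∃ y, y ≠ x ∧ (bridgeless B).Adj w y ∧ (del (bridgeless B) {w}).Reachable y x := by
  classical
  obtain ⟨hwx, hb⟩ := h
  rw [isBridge_iff_forall_walk_mem_edges] at hb
  push Not at hb
  obtain ⟨p₀, hp₀⟩ := hb
  obtain ⟨p, hp, hpe⟩ : ∃ p : B.Walk w x, p.IsPath ∧ s(w, x) ∉ p.edges :=
    ⟨p₀.toPath.1, p₀.toPath.2, fun hh => hp₀ (p₀.edges_toPath_subset_edges hh)⟩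
  have hcyc : (Walk.cons hwx.symm p).IsCycle := by
    rw [Walk.cons_isCycle_iff]
    exact ⟨hp, by rwa [Sym2.eq_swap]⟩
  have hF : ∀ a b, s(a, b) ∈ p.edges → (bridgeless B).Adj a b := fun a b hab =>
    ⟨p.adj_of_mem_edges hab, fun hbr => hbr.notMem_edges_of_isCycle hcyc (by simp [hab])⟩
  cases p with
  | nil => exact (hwx.ne rfl).elim
  | @cons _ y _ hwy q =>
    rw [Walk.cons_isPath_iff] at hp
    refine ⟨y, ?_, hF w y (by simp), ?_⟩
    · rintro rfl
      simp at hpe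
    · refine ⟨q.transfer _ fun e he => ?_⟩
      induction e with | h a b =>
      refine ⟨hF a b (by simp [he]), ?_, ?_⟩
      · rintro rfl
        exact hp.2 (q.fst_mem_support_of_mem_edges he)
      · rintro rfl
        exact hp.2 (q.snd_mem_support_of_mem_edges he)

/-- In a subcubic graph, deleting bridges leaves no cut-vertices. -/
theorem bridgeless_reachable_del (B : SimpleGraph V) (hB : Subcubic B) (w : V) {a b : V}
    (hab : (bridgeless B).Reachable a b) (ha : a ≠ w) (hb : b ≠ w) :
    (del (bridgeless B) {w}).Reachable a b := by
  have hnb : ∀ x y, (bridgeless B).Adj w x → (bridgeless B).Adj w y →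
      (del (bridgeless B) {w}).Reachable x y := by
    intro x y hx hy
    obtain ⟨x', hxne, hwx', hrx⟩ := bridgeless_exists_other_neighbor B hx
    obtain ⟨y', hyne, hwy', hry⟩ := bridgeless_exists_other_neighbor B hy
    by_cases hxy : x = y
    · subst hxy; rfl
    by_cases h1 : x' = y
    · subst h1; exact hrx.symm
    by_cases h2 : y' = x
    · subst h2; exact hry
    by_cases h3 : x' = y'
    · subst h3; exact hrx.symm.trans hry
    exfalso
    have hsub : ({x, y, x', y'} : Set V) ⊆ B.neighborSet w := by
      rintro z (rfl | rfl | rfl | rfl)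
      exacts [hx.1, hy.1, hwx'.1, hwy'.1]
    have h4 := (Set.ncard_le_ncard hsub (hB w).1).trans (hB w).2
    rw [Set.ncard_insert_of_notMem (by simp [hxy, Ne.symm hxne, Ne.symm h2]),
      Set.ncard_insert_of_notMem (by simp [Ne.symm h1, Ne.symm hyne]),
      Set.ncard_pair h3] at h4
    omega
  have key : ∀ {a b : V}, (bridgeless B).Walk a b → b ≠ w →
      (a ≠ w → (del (bridgeless B) {w}).Reachable a b) ∧
      (a = w → ∀ x, (bridgeless B).Adj w x → (del (bridgeless B) {w}).Reachable x b) := by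
    intro a b p
    induction p with
    | nil => exact fun hb => ⟨fun _ => by rfl, fun h => (hb h).elim⟩
    | @cons a c b hac q ih =>
      intro hb
      obtain ⟨ih1, ih2⟩ := ih hb
      refine ⟨fun ha => ?_, fun ha x hx => ?_⟩
      · by_cases hcw : c = w
        · exact ih2 hcw a (hcw ▸ hac.symm)
        · have hadj : (del (bridgeless B) {w}).Adj a c := ⟨hac, ha, hcw⟩
          exact hadj.reachable.trans (ih1 hcw)
      · subst ha
        exact (hnb x c hx hac).trans (ih1 hac.ne')
  obtain ⟨p⟩ := hab
  exact (key p hb).1 ha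

theorem induce_induce_reachable (F : SimpleGraph V) (C : Set V)
    (hC : ∀ x y, x ∈ C → F.Adj x y → y ∈ C) (X : Set C) {a b : V}
    (hab : (del F (Set.image Subtype.val X)).Reachable a b) (ha : a ∈ C) (haX : (⟨a, ha⟩ : C) ∉ X)
    (hb : b ∈ C) (hbX : (⟨b, hb⟩ : C) ∉ X) :
    ((F.induce C).induce Xᶜ).Reachable ⟨⟨a, ha⟩, haX⟩ ⟨⟨b, hb⟩, hbX⟩ := by
  obtain ⟨p⟩ := hab
  induction p with
  | nil => rfl
  | @cons a c b hac q ih =>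
    have hc : c ∈ C := hC a c ha hac.1
    have hcX : (⟨c, hc⟩ : C) ∉ X := fun h => hac.2.2 ⟨_, h, rfl⟩
    refine Reachable.trans (Adj.reachable ?_) (ih hc hcX hb hbX)
    exact hac.1

theorem bridgeless_component_isKConn_two (B : SimpleGraph V) (hB : Subcubic B) {v x : V}
    (hvx : (bridgeless B).Adj v x) :
    IsKConn 2 ((bridgeless B).induce {y | (bridgeless B).Reachable v y}) := by
  obtain ⟨y, hyx, hvy, -⟩ := bridgeless_exists_other_neighbor B hvx
  let C : Set V := {z | (bridgeless B).Reachable v z}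
  have hC : ∀ a b, a ∈ C → (bridgeless B).Adj a b → b ∈ C := fun a b ha hab =>
    Reachable.trans ha hab.reachable
  let f : Fin 3 → C := ![⟨v, Reachable.refl v⟩, ⟨x, hvx.reachable⟩, ⟨y, hvy.reachable⟩]
  have hf : Function.Injective f := by
    have h1 := hvx.ne
    have h2 := hvy.ne
    intro i j hij
    fin_cases i <;> fin_cases j <;> simp_all [f]
  have hcard : (2 : Cardinal) < Cardinal.mk C := by
    have h3 : Cardinal.lift.{u} (Cardinal.mk (Fin 3)) ≤ Cardinal.lift.{0} (Cardinal.mk C) :=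
      Cardinal.lift_mk_le_lift_mk_of_injective hf
    have h4 : (3 : Cardinal.{u}) ≤ Cardinal.mk C := by simpa using h3
    exact lt_of_lt_of_le (by norm_num) h4
  refine ⟨by exact_mod_cast hcard, fun X hX hXc => ?_⟩
  have : Nonempty (Xᶜ : Set C) := by
    by_contra hne
    rw [Set.nonempty_coe_sort, Set.not_nonempty_iff_eq_empty, Set.compl_empty_iff] at hne
    subst hne
    have hle := Set.ncard_le_ncard (Set.subset_univ (Set.range f)) hX
    rw [Set.ncard_range_of_injective hf, Nat.card_fin] at hle
    omega
  refine { preconnected := ?_, nonempty := this }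
  rintro ⟨⟨a, ha⟩, haX⟩ ⟨⟨b, hb⟩, hbX⟩
  refine induce_induce_reachable _ C hC X ?_ ha haX hb hbX
  have hab : (bridgeless B).Reachable a b := Reachable.trans (Reachable.symm ha) hb
  have hsub : X.Subsingleton := by
    have := hX.to_subtype
    rw [← Set.ncard_le_one_iff_subsingleton]
    omega
  rcases hsub.eq_empty_or_singleton with rfl | ⟨w, rfl⟩
  · refine hab.mono fun p q hpq => ⟨hpq, ?_, ?_⟩ <;> simp
  · rw [Set.image_singleton]
    exact bridgeless_reachable_del B hB w hab
      (fun h => haX (Subtype.ext h)) (fun h => hbX (Subtype.ext h))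

theorem path_unique_of_mem_edges {G : SimpleGraph V} {u v : V} (p : G.Path u v)
    (h : s(u, v) ∈ (p : G.Walk u v).edges) (huv : G.Adj u v) : p = Path.singleton huv := by
  obtain ⟨p, hp⟩ := p
  apply Subtype.ext
  cases p with
  | nil => simp at h
  | cons ha q =>
    rw [Walk.cons_isPath_iff] at hp
    simp only [Walk.edges_cons, List.mem_cons] at h
    rcases h with h | h
    · rw [Sym2.congr_right] at h
      subst h
      obtain rfl := (Walk.isPath_iff_nil.mp hp.1).eq_nil
      rfl
    · exact (hp.2 (q.fst_mem_support_of_mem_edges h)).elim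

/-- Internally disjoint distinct paths cross a separating cut in distinct edges. -/
theorem boundary_edge_ne {G : SimpleGraph V} {u v : V} {p q : G.Path u v} (hpq : p ≠ q)
    (hint : ∀ x, x ∈ (p : G.Walk u v).support → x ∈ (q : G.Walk u v).support → x = u ∨ x = v)
    {Y : Set V} (hu : u ∈ Y) (hv : v ∉ Y) {d d' : G.Dart}
    (hd : d ∈ (p : G.Walk u v).darts) (hd' : d' ∈ (q : G.Walk u v).darts)
    (h1 : d.fst ∈ Y) (h2 : d.snd ∉ Y) (h3 : d'.snd ∉ Y) :
    s(d.fst, d.snd) ≠ s(d'.fst, d'.snd) := by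
  intro he
  rcases Sym2.eq_iff.mp he with ⟨hf, hs⟩ | ⟨hf, -⟩
  · have hfu : d.fst = u := (hint _ (Walk.dart_fst_mem_support_of_mem_darts _ hd)
      (hf ▸ Walk.dart_fst_mem_support_of_mem_darts _ hd')).resolve_right
      fun h => hv (h ▸ h1)
    have hsv : d.snd = v := (hint _ (Walk.dart_snd_mem_support_of_mem_darts _ hd)
      (hs ▸ Walk.dart_snd_mem_support_of_mem_darts _ hd')).resolve_left
      fun h => h2 (h.symm ▸ hu)
    have huv : G.Adj u v := hfu ▸ hsv ▸ d.adj
    have hp : s(d.fst, d.snd) ∈ (p : G.Walk u v).edges := List.mem_map_of_mem hd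
    have hq : s(d'.fst, d'.snd) ∈ (q : G.Walk u v).edges := List.mem_map_of_mem hd'
    rw [← he] at hq
    rw [hfu, hsv] at hp hq
    exact hpq ((path_unique_of_mem_edges p hp huv).trans
      (path_unique_of_mem_edges q hq huv).symm)
  · exact h3 (hf ▸ h1)

/-- The restriction of `G` to the edges with both ends in `S`. -/
def restrict (G : SimpleGraph V) (S : Set V) : SimpleGraph V where
  Adj x y := G.Adj x y ∧ x ∈ S ∧ y ∈ S
  symm := ⟨fun _ _ h => ⟨h.1.symm, h.2.2, h.2.1⟩⟩
  loopless := ⟨fun _ h => h.1.ne rfl⟩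

theorem restrict_edgeSet_finite (G : SimpleGraph V) {S : Set V} (hS : S.Finite) :
    (restrict G S).edgeSet.Finite := by
  refine ((hS.prod hS).image fun p : V × V => s(p.1, p.2)).subset ?_
  intro e he
  induction e with | h x y =>
  exact ⟨(x, y), ⟨he.2.1, he.2.2⟩, rfl⟩

/-- If `U` is finite and 3-connected in `G`, there is a finite set of vertices inside which
every cut separating two vertices of `U` has at least three edges. -/
theorem ThreeConnIn.exists_finite_three_edges_cut {G : SimpleGraph V} {U : Set V}
    (hUfin : U.Finite) (hU : ThreeConnIn G U) :
    ∃ S : Set V, S.Finite ∧ U ⊆ S ∧ ∀ u ∈ U, ∀ v ∈ U, ∀ Y : Set V, u ∈ Y → v ∉ Y →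
      ∀ T : Set V, S ⊆ T → ∃ D : Set (Sym2 V), D.ncard = 3 ∧
        ∀ d ∈ D, ∃ x y, (restrict G T).Adj x y ∧ x ∈ Y ∧ y ∉ Y ∧ d = s(x, y) := by
  have hpair : ∀ u v : V, ∃ S : Set V, S.Finite ∧ (u ∈ U → v ∈ U → ∀ Y : Set V, u ∈ Y → v ∉ Y →
      ∀ T : Set V, S ⊆ T → ∃ D : Set (Sym2 V), D.ncard = 3 ∧
        ∀ d ∈ D, ∃ x y, (restrict G T).Adj x y ∧ x ∈ Y ∧ y ∉ Y ∧ d = s(x, y)) := by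
    intro u v
    by_cases h : u ∈ U ∧ v ∈ U ∧ u ≠ v
    swap
    · exact ⟨∅, Set.finite_empty, fun hu hv Y huY hvY =>
        (h ⟨hu, hv, fun huv => hvY (huv ▸ huY)⟩).elim⟩
    obtain ⟨p, q, r, hpq, hpr, hqr, ipq, ipr, iqr⟩ := hU u v h.1 h.2.1 h.2.2
    refine ⟨{x | x ∈ (p : G.Walk u v).support} ∪ {x | x ∈ (q : G.Walk u v).support} ∪
      {x | x ∈ (r : G.Walk u v).support},
      ((List.finite_toSet _).union (List.finite_toSet _)).union (List.finite_toSet _), ?_⟩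
    intro _ _ Y hu hv T hT
    obtain ⟨a, ha, ha1, ha2⟩ := (p : G.Walk u v).exists_boundary_dart Y hu hv
    obtain ⟨b, hb, hb1, hb2⟩ := (q : G.Walk u v).exists_boundary_dart Y hu hv
    obtain ⟨c, hc, hc1, hc2⟩ := (r : G.Walk u v).exists_boundary_dart Y hu hv
    have hab := boundary_edge_ne hpq ipq hu hv ha hb ha1 ha2 hb2
    have hac := boundary_edge_ne hpr ipr hu hv ha hc ha1 ha2 hc2
    have hbc := boundary_edge_ne hqr iqr hu hv hb hc hb1 hb2 hc2
    refine ⟨{s(a.fst, a.snd), s(b.fst, b.snd), s(c.fst, c.snd)},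
      Set.ncard_eq_three.mpr ⟨_, _, _, hab, hac, hbc, rfl⟩, ?_⟩
    rintro d (rfl | rfl | rfl)
    · exact ⟨_, _, ⟨a.adj,
        hT (Or.inl (Or.inl (Walk.dart_fst_mem_support_of_mem_darts _ ha))),
        hT (Or.inl (Or.inl (Walk.dart_snd_mem_support_of_mem_darts _ ha)))⟩, ha1, ha2, rfl⟩
    · exact ⟨_, _, ⟨b.adj,
        hT (Or.inl (Or.inr (Walk.dart_fst_mem_support_of_mem_darts _ hb))),
        hT (Or.inl (Or.inr (Walk.dart_snd_mem_support_of_mem_darts _ hb)))⟩, hb1, hb2, rfl⟩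
    · exact ⟨_, _, ⟨c.adj,
        hT (Or.inr (Walk.dart_fst_mem_support_of_mem_darts _ hc)),
        hT (Or.inr (Walk.dart_snd_mem_support_of_mem_darts _ hc))⟩, hc1, hc2, rfl⟩
  choose S hSfin hS using hpair
  refine ⟨U ∪ ⋃ u ∈ U, ⋃ v ∈ U, S u v,
    hUfin.union (hUfin.biUnion fun u _ => hUfin.biUnion fun v _ => hSfin u v),
    Set.subset_union_left, fun u hu v hv Y huY hvY T hT => ?_⟩
  refine hS u v hu hv Y huY hvY T (Set.Subset.trans ?_ hT)
  exact fun x hx => Or.inr (Set.mem_biUnion hu (Set.mem_biUnion hv hx))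

/-- In a subcubic graph `G`, for a finite collection `𝒰` of finite subsets
of `V(G)`, each 3-connected in `G`, there is a finite subgraph `F` such that each
`U ∈ 𝒰` lies in a single component of `F`, and every component of `F` is an isolated
vertex or a 2-connected bipartite graph. -/
theorem exists_component_bipartite {V : Type u} (G : SimpleGraph V) (hsc : Subcubic G)
    (𝒰 : Set (Set V)) (h𝒰 : 𝒰.Finite) (hUfin : ∀ U ∈ 𝒰, U.Finite)
    (hU3 : ∀ U ∈ 𝒰, ThreeConnIn G U) :
    ∃ F : G.Subgraph, F.verts.Finite ∧
      (∀ U ∈ 𝒰, U ⊆ F.verts ∧ ∀ u ∈ U, ∀ v ∈ U, F.spanningCoe.Reachable u v) ∧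
      ∀ v ∈ F.verts,
        {x | F.spanningCoe.Reachable v x} = {v} ∨
          (IsKConn 2 (F.spanningCoe.induce {x | F.spanningCoe.Reachable v x}) ∧
            (F.spanningCoe.induce {x | F.spanningCoe.Reachable v x}).Colorable 2) := by
  have hS : ∀ U : Set V, ∃ S : Set V, S.Finite ∧ (U ∈ 𝒰 → U ⊆ S ∧ ∀ u ∈ U, ∀ v ∈ U,
      ∀ Y : Set V, u ∈ Y → v ∉ Y → ∀ T : Set V, S ⊆ T → ∃ D : Set (Sym2 V), D.ncard = 3 ∧
        ∀ d ∈ D, ∃ x y, (restrict G T).Adj x y ∧ x ∈ Y ∧ y ∉ Y ∧ d = s(x, y)) := by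
    intro U
    by_cases hU : U ∈ 𝒰
    · obtain ⟨S, hfin, hsub, h⟩ := (hU3 U hU).exists_finite_three_edges_cut (hUfin U hU)
      exact ⟨S, hfin, fun _ => ⟨hsub, h⟩⟩
    · exact ⟨∅, Set.finite_empty, fun h => (hU h).elim⟩
  choose S hSfin hS using hS
  let T : Set V := ⋃ U ∈ 𝒰, S U
  have hTfin : T.Finite := h𝒰.biUnion fun U _ => hSfin U
  have hST : ∀ U ∈ 𝒰, S U ⊆ T := fun U hU => Set.subset_biUnion_of_mem hU
  have hHfin := restrict_edgeSet_finite G hTfin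
  obtain ⟨c, hc⟩ := exists_maximum_cutGraph (restrict G T) hHfin
  let B := cutGraph (restrict G T) c
  have hB : Subcubic B := fun v =>
    have hsub : B.neighborSet v ⊆ G.neighborSet v := fun _ h => h.1.1
    ⟨(hsc v).1.subset hsub, (Set.ncard_le_ncard hsub (hsc v).1).trans (hsc v).2⟩
  let F : G.Subgraph :=
    { verts := T
      Adj := (bridgeless B).Adj
      adj_sub := fun h => h.1.1.1
      edge_vert := fun h => h.1.1.2.1
      symm := (bridgeless B).symm }
  refine ⟨F, hTfin, fun U hU => ⟨(hS U hU).1.trans (hST U hU), fun u hu v hv => ?_⟩,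
    fun v _ => ?_⟩
  · refine bridgeless_reachable B fun e => ?_
    by_contra hne
    obtain ⟨D, hD3, hD⟩ := (hS U hU).2 u hu v hv
      {x | (B.deleteEdges {e}).Reachable u x} (Reachable.refl u) hne T (hST U hU)
    have hle := ncard_le_two_of_maximum_cutGraph _ hHfin c hc _ e
      (fun x y hxy hx hy => ?_) D hD
    · omega
    · by_contra hxye
      refine hy (Reachable.trans hx (Adj.reachable ?_))
      rw [deleteEdges_adj]
      exact ⟨hxy, hxye⟩
  · by_cases hv : ∃ x, (bridgeless B).Adj v x
    · obtain ⟨x, hx⟩ := hv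
      refine Or.inr ⟨bridgeless_component_isKConn_two B hB hx, ?_⟩
      let C : ((bridgeless B).induce {x | (bridgeless B).Reachable v x}).Coloring Bool :=
        Coloring.mk (fun y => c y.1) fun {a b} (h : (bridgeless B).Adj a.1 b.1) => h.1.2
      exact C.colorable
    · refine Or.inl (Set.eq_singleton_iff_unique_mem.mpr ⟨Reachable.refl v, ?_⟩)
      rintro x ⟨p⟩
      cases p with
      | nil => rfl
      | cons h _ => exact (hv ⟨_, h⟩).elim

end IGraph
end

section
/- Let G be a 3-connected cubic graph and S a finite subset of V(G). Then there is a finite subset T of V(G) with S ∪ N_G(S) ⊆ T such that for every component H of G − T, the set N_G(V(H)) is 3-connected in G − S. -/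
namespace IGraph

open SimpleGraph

universe u w

variable {V : Type u} {W : Type w}

/-- `a` and `b` cannot be separated in `H` by deleting at most two edges. -/
def ThreeEdgeLinked (H : SimpleGraph V) (a b : V) : Prop :=
  ∀ e f : Sym2 V, (H.deleteEdges {e, f}).Reachable a b

/-- A finite set of darts without opposite pairs which forms an integral unit-capacity flow of
value `k` from `u` to `v`; conservation is tested against all potentials `φ`. -/
structure IsUnitFlow {H : SimpleGraph V} (D : Finset H.Dart) (u v : V) (k : ℤ) : Prop where
  symm_notMem : ∀ d ∈ D, d.symm ∉ D
  net : ∀ φ : V → ℤ, ∑ d ∈ D, (φ d.fst - φ d.snd) = k * (φ u - φ v)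

section Flow

variable {H : SimpleGraph V} {u v : V} {D : Finset H.Dart} {k : ℤ}

/-- Either a path from `u` to `v` uses only darts satisfying `Q`, or some vertex set separating
`u` from `v` is closed under the darts satisfying `Q`. -/
lemma exists_path_or_closed (Q : H.Dart → Prop) (u v : V) :
    (∃ p : H.Path u v, ∀ d ∈ (p : H.Walk u v).darts, Q d) ∨
      ∃ R : Set V, u ∈ R ∧ v ∉ R ∧ ∀ d : H.Dart, Q d → d.fst ∈ R → d.snd ∈ R := by
  classical
  by_cases hv : ∃ p : H.Walk u v, ∀ d ∈ p.darts, Q d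
  · obtain ⟨p, hp⟩ := hv
    exact .inl ⟨p.toPath, fun d hd => hp d (p.darts_toPath_subset_darts hd)⟩
  · refine .inr ⟨{x | ∃ p : H.Walk u x, ∀ d ∈ p.darts, Q d}, ⟨.nil, by simp⟩, hv, ?_⟩
    rintro d hd ⟨p, hp⟩
    refine ⟨p.concat d.adj, fun d' hd' => ?_⟩
    rw [Walk.darts_concat, List.concat_eq_append, List.mem_append, List.mem_singleton] at hd'
    rcases hd' with hd' | rfl
    exacts [hp d' hd', hd]

lemma sum_darts_toFinset [DecidableEq H.Dart] (p : H.Path u v) (φ : V → ℤ) :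
    ∑ d ∈ (p : H.Walk u v).darts.toFinset, (φ d.fst - φ d.snd) = φ u - φ v := by
  rw [List.sum_toFinset _ (Walk.darts_nodup_of_support_nodup p.2.support_nodup)]
  obtain ⟨q, hq⟩ := p
  change (q.darts.map fun d => φ d.fst - φ d.snd).sum = φ u - φ v
  clear hq
  induction q with
  | nil => simp
  | cons h q ih => simp [ih]

/-- Cancelling opposite pairs of darts does not change the net flow. -/
lemma exists_isUnitFlow_of_net
    (hD : ∀ φ : V → ℤ, ∑ d ∈ D, (φ d.fst - φ d.snd) = k * (φ u - φ v)) :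
    ∃ D' : Finset H.Dart, IsUnitFlow D' u v k := by
  classical
  refine ⟨D.filter fun d => d.symm ∉ D, ?_, fun φ => ?_⟩
  · intro d hd hd'
    simp only [Finset.mem_filter] at hd hd'
    exact hd.2 hd'.1
  · rw [← hD φ, ← Finset.sum_filter_add_sum_filter_not D (fun d => d.symm ∉ D), left_eq_add]
    refine Finset.sum_involution (fun d _ => d.symm) ?_ ?_ ?_ ?_
    · intro d _
      simp [Dart.symm]
    · intro d _ _ h
      exact d.symm_ne h
    · intro d hd
      simp only [Finset.mem_filter, not_not] at hd ⊢
      exact ⟨hd.2, by simpa using hd.1⟩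
    · intro d _
      simp

lemma IsUnitFlow.exists_succ (hD : IsUnitFlow D u v k) (hk : k ≤ 2)
    (huv : ThreeEdgeLinked H u v) : ∃ D' : Finset H.Dart, IsUnitFlow D' u v (k + 1) := by
  classical
  rcases exists_path_or_closed (fun d : H.Dart => d ∉ D) u v with ⟨p, hp⟩ | ⟨R, hu, hv, hR⟩
  · refine exists_isUnitFlow_of_net (D := D ∪ (p : H.Walk u v).darts.toFinset) fun φ => ?_
    rw [Finset.sum_union, hD.net, sum_darts_toFinset]
    · ring
    · rw [Finset.disjoint_right]
      exact fun d hd => hp d (by simpa using hd)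
  · exfalso
    have hsum := hD.net (R.indicator 1)
    set O := D.filter fun d => d.fst ∈ R ∧ d.snd ∉ R with hO
    have hcard : ∑ d ∈ D, (R.indicator (1 : V → ℤ) d.fst - R.indicator 1 d.snd) = O.card := by
      rw [hO, Finset.card_filter, Nat.cast_sum]
      refine Finset.sum_congr rfl fun d hd => ?_
      by_cases h1 : d.fst ∈ R <;> by_cases h2 : d.snd ∈ R
      · simp [h1, h2]
      · simp [h1, h2]
      · exact absurd (hR d.symm (hD.symm_notMem d hd) h2) h1
      · simp [h1, h2]
    have hle : (O.image Dart.edge).card ≤ 2 := by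
      refine Finset.card_image_le.trans ?_
      rw [hcard] at hsum
      simp only [Set.indicator_of_mem hu, Set.indicator_of_notMem hv, Pi.one_apply] at hsum
      omega
    obtain ⟨e, f, hef⟩ : ∃ e f : Sym2 V, ∀ g ∈ O.image Dart.edge, g = e ∨ g = f := by
      have : Nonempty (Sym2 V) := ⟨s(u, v)⟩
      rcases Nat.lt_or_ge (O.image Dart.edge).card 2 with h | h
      · obtain ⟨e, he⟩ := Finset.card_le_one_iff_subset_singleton.1 (Nat.lt_succ_iff.1 h)
        exact ⟨e, e, fun g hg => .inl (by simpa using he hg)⟩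
      · obtain ⟨e, f, -, he⟩ := Finset.card_eq_two.1 (le_antisymm hle h)
        exact ⟨e, f, fun g hg => by simpa [he] using hg⟩
    obtain ⟨q⟩ := huv e f
    obtain ⟨d, -, h1, h2⟩ := q.exists_boundary_dart R hu hv
    have hadj := d.adj
    rw [deleteEdges_adj] at hadj
    let d' : H.Dart := ⟨d.toProd, hadj.1⟩
    have hd' : d' ∈ D := by
      by_contra h
      exact h2 (hR d' h h1)
    exact hadj.2 (hef _ (Finset.mem_image.2 ⟨d', Finset.mem_filter.2 ⟨hd', h1, h2⟩, rfl⟩))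

lemma ThreeEdgeLinked.exists_isUnitFlow (huv : ThreeEdgeLinked H u v) :
    ∃ D : Finset H.Dart, IsUnitFlow D u v 3 := by
  have h0 : IsUnitFlow (∅ : Finset H.Dart) u v 0 := ⟨by simp, by simp⟩
  obtain ⟨D₁, h₁⟩ := h0.exists_succ (by norm_num) huv
  obtain ⟨D₂, h₂⟩ := h₁.exists_succ (by norm_num) huv
  exact h₂.exists_succ (by norm_num) huv

/-- A path can be split off any flow of positive value. -/
lemma IsUnitFlow.exists_path [DecidableEq H.Dart] (hD : IsUnitFlow D u v k) (hk : 0 < k) :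
    ∃ p : H.Path u v, (∀ d ∈ (p : H.Walk u v).darts, d ∈ D) ∧
      IsUnitFlow (D \ (p : H.Walk u v).darts.toFinset) u v (k - 1) := by
  classical
  rcases exists_path_or_closed (fun d : H.Dart => d ∈ D) u v with ⟨p, hp⟩ | ⟨R, hu, hv, hR⟩
  · refine ⟨p, hp, fun d hd hd' => ?_, fun φ => ?_⟩
    · exact hD.symm_notMem d (Finset.mem_sdiff.1 hd).1 (Finset.mem_sdiff.1 hd').1
    · have h := Finset.sum_sdiff (s₁ := (p : H.Walk u v).darts.toFinset) (s₂ := D)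
        (f := fun d => φ d.fst - φ d.snd) fun d hd => hp d (by simpa using hd)
      rw [sum_darts_toFinset, hD.net] at h
      linarith
  · exfalso
    have hsum := hD.net (R.indicator 1)
    have hle : ∑ d ∈ D, (R.indicator (1 : V → ℤ) d.fst - R.indicator 1 d.snd) ≤ 0 := by
      refine Finset.sum_nonpos fun d hd => ?_
      by_cases h1 : d.fst ∈ R
      · simp [h1, hR d hd h1]
      · by_cases h2 : d.snd ∈ R <;> simp [h1, h2]
    rw [hsum] at hle
    simp only [Set.indicator_of_mem hu, Set.indicator_of_notMem hv, Pi.one_apply] at hle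
    omega

lemma exists_darts_at_of_mem_support {p : H.Walk u v} {x : V} (hx : x ∈ p.support)
    (hu : x ≠ u) (hv : x ≠ v) :
    (∃ d ∈ p.darts, d.snd = x) ∧ ∃ d ∈ p.darts, d.fst = x := by
  constructor
  · rw [← Walk.cons_map_snd_darts, List.mem_cons] at hx
    simpa using hx.resolve_left hu
  · rw [← Walk.map_fst_darts_append, List.mem_append, List.mem_singleton] at hx
    simpa using hx.resolve_right hv

/-- In a subcubic graph, paths using disjoint parts of an antisymmetric set of darts can only
meet at their ends. -/
lemma eq_or_eq_of_mem_support_of_disjoint_darts (hH : Subcubic H)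
    (hD : ∀ d ∈ D, d.symm ∉ D) {p q : H.Walk u v}
    (hp : ∀ d ∈ p.darts, d ∈ D) (hq : ∀ d ∈ q.darts, d ∈ D) (hpq : ∀ d ∈ p.darts, d ∉ q.darts)
    {x : V} (hxp : x ∈ p.support) (hxq : x ∈ q.support) : x = u ∨ x = v := by
  classical
  by_contra! hx
  obtain ⟨⟨a, ha, rfl⟩, b, hb, hbx⟩ := exists_darts_at_of_mem_support hxp hx.1 hx.2
  obtain ⟨⟨c, hc, hcx⟩, d, hd, hdx⟩ := exists_darts_at_of_mem_support hxq hx.1 hx.2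
  have hin : ∀ {s t : H.Dart}, s.snd = t.snd → s.fst = t.fst → s = t := fun h h' =>
    Dart.ext _ _ (Prod.ext h' h)
  have hopp : ∀ {s t : H.Dart}, s ∈ D → t ∈ D → s.snd = t.fst → s.fst ≠ t.snd := by
    intro s t hs ht h h'
    have : t = s.symm := Dart.ext _ _ (Prod.ext h.symm h'.symm)
    exact hD s hs (this ▸ ht)
  have hab := hopp (hp a ha) (hp b hb) hbx.symm
  have had := hopp (hp a ha) (hq d hd) hdx.symm
  have hcb := hopp (hq c hc) (hp b hb) (hcx.trans hbx.symm)
  have hcd := hopp (hq c hc) (hq d hd) (hcx.trans hdx.symm)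
  have hac : a.fst ≠ c.fst := fun h => hpq a ha (hin hcx.symm h ▸ hc)
  have hbd : b.snd ≠ d.snd := fun h => hpq b hb (hin h (hbx.trans hdx.symm) ▸ hd)
  have hsub : ((({a.fst, b.snd, c.fst, d.snd} : Finset V) : Set V)) ⊆ H.neighborSet a.snd := by
    intro y hy
    simp only [Finset.coe_insert, Finset.coe_singleton, Set.mem_insert_iff,
      Set.mem_singleton_iff] at hy
    rcases hy with rfl | rfl | rfl | rfl
    · exact a.adj.symm
    · exact hbx ▸ b.adj
    · exact hcx ▸ c.adj.symm
    · exact hdx ▸ d.adj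
  have hcard := (Set.ncard_le_ncard hsub (hH _).1).trans (hH _).2
  rw [Set.ncard_coe_finset, Finset.card_insert_of_notMem (by simp [hab, hac, had]),
    Finset.card_insert_of_notMem (by simp [hcb.symm, hbd]),
    Finset.card_insert_of_notMem (by simp [hcd]), Finset.card_singleton] at hcard
  omega

/-- Menger's theorem for three paths in a subcubic graph. -/
theorem threeConnIn_of_threeEdgeLinked (hH : Subcubic H) {A : Set V}
    (hA : ∀ a ∈ A, ∀ b ∈ A, ThreeEdgeLinked H a b) : ThreeConnIn H A := by
  classical
  intro u v hu hv huv
  obtain ⟨D, hD⟩ := (hA u hu v hv).exists_isUnitFlow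
  obtain ⟨p, hp, hD₁⟩ := hD.exists_path (by norm_num)
  obtain ⟨q, hq, hD₂⟩ := hD₁.exists_path (by norm_num)
  obtain ⟨r, hr, -⟩ := hD₂.exists_path (by norm_num)
  simp only [Finset.mem_sdiff, List.mem_toFinset] at hq hr
  have hne : ∀ {s t : H.Path u v},
      (∀ d ∈ (s : H.Walk u v).darts, d ∉ (t : H.Walk u v).darts) → s ≠ t := by
    rintro s _ hst rfl
    have hnil : (s : H.Walk u v).darts = [] := List.eq_nil_iff_forall_not_mem.2
      fun d hd => hst d hd hd
    exact huv (Walk.darts_eq_nil.1 hnil).eq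
  have hpq : ∀ d ∈ (p : H.Walk u v).darts, d ∉ (q : H.Walk u v).darts :=
    fun d hd hd' => (hq d hd').2 hd
  have hpr : ∀ d ∈ (p : H.Walk u v).darts, d ∉ (r : H.Walk u v).darts :=
    fun d hd hd' => (hr d hd').1.2 hd
  have hqr : ∀ d ∈ (q : H.Walk u v).darts, d ∉ (r : H.Walk u v).darts :=
    fun d hd hd' => (hr d hd').2 hd
  have hqD := fun d hd => (hq d hd).1
  have hrD := fun d hd => (hr d hd).1.1
  have hmeet := @eq_or_eq_of_mem_support_of_disjoint_darts V H u v D hH hD.symm_notMem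
  exact ⟨p, q, r, hne hpq, hne hpr, hne hqr, fun _ => hmeet hp hqD hpq,
    fun _ => hmeet hp hrD hpr, fun _ => hmeet hqD hrD hqr⟩

end Flow

lemma ThreeEdgeLinked.symm {H : SimpleGraph V} {a b : V} (h : ThreeEdgeLinked H a b) :
    ThreeEdgeLinked H b a := fun e f => (h e f).symm

lemma ThreeEdgeLinked.trans {H : SimpleGraph V} {a b c : V} (h : ThreeEdgeLinked H a b)
    (h' : ThreeEdgeLinked H b c) : ThreeEdgeLinked H a c := fun e f => (h e f).trans (h' e f)

lemma Cubic.finite_neighborSet {G : SimpleGraph V} (hG : Cubic G) (v : V) :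
    (G.neighborSet v).Finite :=
  Set.finite_of_ncard_ne_zero (by rw [hG v]; norm_num)

lemma Cubic.subcubic_del {G : SimpleGraph V} (hG : Cubic G) (S : Set V) :
    Subcubic (del G S) := fun v => by
  have hsub : (del G S).neighborSet v ⊆ G.neighborSet v := fun _ h => h.1
  exact ⟨(hG.finite_neighborSet v).subset hsub,
    (Set.ncard_le_ncard hsub (hG.finite_neighborSet v)).trans (hG v).le⟩

lemma Cubic.finite_nSet {G : SimpleGraph V} (hG : Cubic G) {S : Set V} (hS : S.Finite) :
    (NSet G S).Finite :=
  (hS.biUnion fun x _ => hG.finite_neighborSet x).subset fun _ ⟨_, _, hx, h⟩ =>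
    Set.mem_biUnion hx h

/-- In a cubic graph, a nonempty vertex set with at most two boundary edges is not a singleton. -/
lemma Cubic.exists_mem_ne {G : SimpleGraph V} (hG : Cubic G) {A : Set V} (hA : A.Nonempty)
    {e f : Sym2 V} (hef : ∀ x ∈ A, ∀ y ∉ A, G.Adj x y → s(x, y) = e ∨ s(x, y) = f) (z : V) :
    ∃ x ∈ A, x ≠ z := by
  by_contra! h
  obtain ⟨a, ha⟩ := hA
  have hsub : (fun y => s(a, y)) '' G.neighborSet a ⊆ {e, f} := by
    rintro _ ⟨y, hy, rfl⟩
    refine hef a ha y (fun hyA => G.ne_of_adj hy ?_) hy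
    rw [h a ha, h y hyA]
  have hcard := (Set.ncard_le_ncard hsub (Set.toFinite _)).trans (Set.ncard_insert_le e {f})
  rw [Set.ncard_image_of_injective _ fun _ _ h => Sym2.congr_right.1 h, hG a,
    Set.ncard_singleton] at hcard
  omega

/-- A 3-connected cubic graph has no edge cut of size at most two. -/
lemma not_boundary_subset_pair {G : SimpleGraph V} (hG : Cubic G) (h3 : IsKConn 3 G) {A : Set V}
    {a b : V} (ha : a ∈ A) (hb : b ∉ A) (e f : Sym2 V) :
    ¬ ∀ x ∈ A, ∀ y ∉ A, G.Adj x y → s(x, y) = e ∨ s(x, y) = f := by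
  intro hef
  obtain ⟨a₁, ha₁, he⟩ : ∃ a₁ ∈ A, ∀ x ∈ A, ∀ y ∉ A, s(x, y) = e → x = a₁ := by
    by_cases h : ∃ x ∈ A, ∃ y ∉ A, s(x, y) = e
    · obtain ⟨x, hx, y, hy, rfl⟩ := h
      refine ⟨x, hx, fun x' hx' y' hy' h => ?_⟩
      rcases Sym2.eq_iff.1 h with h | h
      exacts [h.1, absurd (h.1 ▸ hx') hy]
    · exact ⟨a, ha, fun x hx y hy hxy => absurd ⟨x, hx, y, hy, hxy⟩ h⟩
  obtain ⟨b₁, hb₁, hf⟩ : ∃ b₁ ∉ A, ∀ x ∈ A, ∀ y ∉ A, s(x, y) = f → y = b₁ := by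
    by_cases h : ∃ x ∈ A, ∃ y ∉ A, s(x, y) = f
    · obtain ⟨x, hx, y, hy, rfl⟩ := h
      refine ⟨y, hy, fun x' hx' y' hy' h => ?_⟩
      rcases Sym2.eq_iff.1 h with h | h
      exacts [h.2, absurd (h.1 ▸ hx') hy]
    · exact ⟨b, hb, fun x hx y hy hxy => absurd ⟨x, hx, y, hy, hxy⟩ h⟩
  obtain ⟨x, hx, hxa⟩ := hG.exists_mem_ne ⟨a, ha⟩ hef a₁
  obtain ⟨y, hy, hyb⟩ := hG.exists_mem_ne (A := Aᶜ) ⟨b, hb⟩ (e := e) (f := f)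
    (fun s hs t ht hst => by
      rw [Sym2.eq_swap]
      exact hef t (not_not.1 ht) s hs hst.symm) b₁
  have hcard : ({a₁, b₁} : Set V).ncard < 3 := by
    have := Set.ncard_insert_le a₁ {b₁}
    rw [Set.ncard_singleton] at this
    omega
  have hxX : x ∈ ({a₁, b₁} : Set V)ᶜ := by
    rintro (h | h)
    exacts [hxa h, hb₁ (h ▸ hx)]
  have hyX : y ∈ ({a₁, b₁} : Set V)ᶜ := by
    rintro (h | h)
    exacts [hy (h ▸ ha₁), hyb h]
  obtain ⟨p⟩ := (h3.2 _ (Set.toFinite _) hcard).preconnected ⟨x, hxX⟩ ⟨y, hyX⟩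
  obtain ⟨d, -, h1, h2⟩ := p.exists_boundary_dart {z | (z : V) ∈ A} hx hy
  rcases hef _ h1 _ h2 d.adj with h | h
  · exact d.fst.2 (.inl (he _ h1 _ h2 h))
  · exact d.snd.2 (.inr (hf _ h1 _ h2 h))

lemma notMem_of_reachable_del {G H : SimpleGraph V} {S : Set V} (hH : H ≤ del G S) {a b : V}
    (ha : a ∉ S) (h : H.Reachable a b) : b ∉ S := by
  obtain ⟨p⟩ := h
  induction p with
  | nil => exact ha
  | cons hadj _ ih => exact ih (hH hadj).2.2

/-- Each side of a cut of `G − S` with at most two edges meets `N(S)`. -/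
lemma exists_mem_nSet_reachable {G : SimpleGraph V} (hG : Cubic G) (h3 : IsKConn 3 G)
    {S : Set V} {a b : V} {e f : Sym2 V} (ha : a ∉ S)
    (hab : ¬ ((del G S).deleteEdges {e, f}).Reachable a b) :
    ∃ s ∈ NSet G S, ((del G S).deleteEdges {e, f}).Reachable a s := by
  by_contra! hN
  refine not_boundary_subset_pair hG h3
    (A := {x | ((del G S).deleteEdges {e, f}).Reachable a x}) (Reachable.refl a) hab e f ?_
  intro x hx y hy hxy
  have hxS : x ∉ S := notMem_of_reachable_del (deleteEdges_le _) ha hx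
  have hyS : y ∉ S := fun h => hN x ⟨hxS, y, h, hxy.symm⟩ hx
  by_contra h
  exact hy (hx.trans (Adj.reachable (deleteEdges_adj.2 ⟨⟨hxy, hxS, hyS⟩, h⟩)))

/-- Every edge set separating two connected vertices meets a fixed finite edge set. -/
lemma exists_finite_edges_meeting_cuts (H : SimpleGraph V) (s t : V) :
    ∃ E : Set (Sym2 V), E.Finite ∧ ∀ C : Set (Sym2 V), H.Reachable s t →
      ¬ (H.deleteEdges C).Reachable s t → ∃ e ∈ C, e ∈ E := by
  by_cases h : H.Reachable s t
  · obtain ⟨p⟩ := h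
    refine ⟨{e | e ∈ p.edges}, p.edges.finite_toSet, fun C _ hC => ?_⟩
    by_contra! hE
    exact hC ⟨p.toDeleteEdges C fun e he heC => hE e heC he⟩
  · exact ⟨∅, Set.finite_empty, fun _ hst => absurd hst h⟩

/-- Only finitely many edges of `G − S` have ends separated by at most two edges. -/
lemma finite_setOf_adj_not_threeEdgeLinked {G : SimpleGraph V} (hG : Cubic G)
    (h3 : IsKConn 3 G) {S : Set V} (hS : S.Finite) :
    {x | ∃ y, (del G S).Adj x y ∧ ¬ ThreeEdgeLinked (del G S) x y}.Finite := by
  choose E hEfin hE using exists_finite_edges_meeting_cuts (V := V)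
  set H := del G S
  have hN := hG.finite_nSet hS
  have hfin : (⋃ s ∈ NSet G S, ⋃ t ∈ NSet G S,
      (E H s t ∪ ⋃ g ∈ E H s t, E (H.deleteEdges {g}) s t)).Finite :=
    hN.biUnion fun s _ => hN.biUnion fun t _ =>
      (hEfin H s t).union ((hEfin H s t).biUnion fun g _ => hEfin _ s t)
  refine (hfin.biUnion (t := fun e : Sym2 V => {x | x ∈ e}) fun e _ => ?_).subset ?_
  · induction e with
    | _ a b => exact (Set.toFinite {a, b}).subset fun x hx => by simpa using hx
  rintro a ⟨b, hab, hnot⟩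
  obtain ⟨f, hf⟩ : ∃ f, ¬ (H.deleteEdges {s(a, b), f}).Reachable a b := by
    simp only [ThreeEdgeLinked, not_forall] at hnot
    obtain ⟨e, f, hef⟩ := hnot
    have hmem : s(a, b) ∈ ({e, f} : Set (Sym2 V)) := by
      by_contra h
      exact hef (Adj.reachable (deleteEdges_adj.2 ⟨hab, h⟩))
    rcases hmem with rfl | rfl
    exacts [⟨f, hef⟩, ⟨e, by rwa [Set.pair_comm]⟩]
  obtain ⟨s, hs, has⟩ := exists_mem_nSet_reachable hG h3 hab.2.1 hf
  obtain ⟨t, ht, hbt⟩ := exists_mem_nSet_reachable hG h3 hab.2.2 fun h => hf h.symm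
  have hst : ¬ (H.deleteEdges {s(a, b), f}).Reachable s t := fun h =>
    hf ((has.trans h).trans hbt.symm)
  have hreach : ∀ K : SimpleGraph V, H.deleteEdges {s(a, b), f} ≤ K → K.Adj a b →
      K.Reachable s t := fun K hK hKab =>
    ((has.mono hK).symm.trans hKab.reachable).trans (hbt.mono hK)
  refine Set.mem_biUnion (x := s(a, b)) ?_ (Sym2.mem_mk_left a b)
  refine Set.mem_biUnion hs (Set.mem_biUnion ht ?_)
  obtain ⟨g, hg, hgE⟩ := hE H s t _ (hreach H (deleteEdges_le _) hab) hst
  by_cases hfab : s(a, b) = f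
  · left
    rcases hg with rfl | rfl
    exacts [hgE, hfab ▸ hgE]
  rcases hg with rfl | rfl
  · exact .inl hgE
  · refine .inr (Set.mem_biUnion hgE ?_)
    obtain ⟨c, rfl, hc⟩ := hE (H.deleteEdges {g}) s t {s(a, b)}
      (hreach _ (deleteEdges_anti (by simp)) (deleteEdges_adj.2 ⟨hab, hfab⟩))
      (by rwa [deleteEdges_deleteEdges, Set.singleton_union, Set.pair_comm])
    exact hc

/-- In a 3-connected cubic graph `G`, every finite `S` extends to a finite
`T ⊇ S ∪ N_G(S)` such that for every component `H` of `G − T`, `N_G(V(H))` is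
3-connected in `G − S`. -/
theorem exists_neighborhood_threeconnected {V : Type u} (G : SimpleGraph V)
    (hcubic : Cubic G) (h3 : IsKConn 3 G) (S : Set V) (hSfin : S.Finite) :
    ∃ T : Set V, T.Finite ∧ S ∪ NSet G S ⊆ T ∧
      ∀ v : V, v ∉ T → ThreeConnIn (del G S) (NSet G (compOf G T v)) := by
  refine ⟨S ∪ NSet G S ∪ {x | ∃ y, (del G S).Adj x y ∧ ¬ ThreeEdgeLinked (del G S) x y},
    (hSfin.union (hcubic.finite_nSet hSfin)).union
      (finite_setOf_adj_not_threeEdgeLinked hcubic h3 hSfin), Set.subset_union_left, ?_⟩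
  intro v hv
  set T := S ∪ NSet G S ∪ {x | ∃ y, (del G S).Adj x y ∧ ¬ ThreeEdgeLinked (del G S) x y}
  have hlink : ∀ x y, x ∉ T → G.Adj x y → ThreeEdgeLinked (del G S) x y := by
    intro x y hx hxy
    have hxS : x ∉ S := fun h => hx (.inl (.inl h))
    have hyS : y ∉ S := fun h => hx (.inl (.inr ⟨hxS, y, h, hxy.symm⟩))
    by_contra h
    exact hx (.inr ⟨y, ⟨hxy, hxS, hyS⟩, h⟩)
  have hcomp : ∀ x, (del G T).Reachable v x → ThreeEdgeLinked (del G S) v x := by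
    rintro x ⟨p⟩
    clear hv
    induction p with
    | nil => exact fun _ _ => .refl _
    | cons h _ ih => exact (hlink _ _ h.2.1 h.1).trans ih
  have hnbr : ∀ x ∈ NSet G (compOf G T v), ThreeEdgeLinked (del G S) v x := by
    rintro x ⟨-, y, hy, hyx⟩
    exact (hcomp y hy).trans (hlink y x (notMem_of_reachable_del le_rfl hv hy) hyx)
  exact threeConnIn_of_threeEdgeLinked (hcubic.subcubic_del S)
    fun a ha b hb => (hnbr a ha).symm.trans (hnbr b hb)

end IGraph
end
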